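/- arXiv:1502.03962 — 3 statements merged into one kernel-verified Lean document; each statement's English description precedes it below -/
import Mathlib

section
/- There exists Λ > 0 such that for every λ ∈ (0, Λ], the boundary value problem (P_λ) admits a positive solution u₀ and an infinite sequence {u_ℓ}_{ℓ=1}^∞ of solutions, together with an infinite sequence of real numbers d∞ > d₁ > d₂ > ⋯ > d_ℓ > ⋯ > 0, such that for each ℓ ≥ 1 one has u_ℓ(0) = d_ℓ and u_ℓ has precisely ℓ zeroes in (0, R). -/
open Set Filter Topology MeasureTheory

noncomputable section

/-- Hypotheses (φ1)-(φ3) on `φ : (0,∞) → (0,∞)`, a twice differentiable C¹ function: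
positivity, regularity, `tφ(t) → 0` as `t → 0⁺`, `tφ(t) → ∞` as `t → ∞`,
strict monotonicity of `t ↦ tφ(t)`, and `γ₁ - 1 ≤ (tφ(t))'/φ(t) ≤ γ₂ - 1` with `γ₁, γ₂ > 1`. -/
def PhiHyp (φ : ℝ → ℝ) (γ₁ γ₂ : ℝ) : Prop :=
  (∀ t > (0:ℝ), 0 < φ t) ∧
  ContDiffOn ℝ 1 φ (Set.Ioi 0) ∧
  (∀ t > (0:ℝ), DifferentiableAt ℝ (deriv φ) t) ∧
  Filter.Tendsto (fun t => t * φ t) (nhdsWithin 0 (Set.Ioi 0)) (nhds 0) ∧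
  Filter.Tendsto (fun t => t * φ t) Filter.atTop Filter.atTop ∧
  StrictMonoOn (fun t => t * φ t) (Set.Ioi 0) ∧
  1 < γ₁ ∧ 1 < γ₂ ∧
  ∀ t > (0:ℝ), γ₁ - 1 ≤ deriv (fun s => s * φ s) t / φ t ∧
               deriv (fun s => s * φ s) t / φ t ≤ γ₂ - 1

/-- Hypotheses on `f`: continuity, `C¹` on `ℝ \ {0}`, (f1) `t f(t) > 0` for `t ≠ 0`,
and (f2) `f` nondecreasing on `(-∞, d∞]` with `d∞ > 0`. -/
def FHyp (f : ℝ → ℝ) (dinf : ℝ) : Prop :=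
  Continuous f ∧ ContDiffOn ℝ 1 f {(0:ℝ)}ᶜ ∧
  (∀ t : ℝ, t ≠ 0 → 0 < t * f t) ∧
  0 < dinf ∧ MonotoneOn f (Set.Iic dinf)

/-- Hypothesis (f3): the two one-sided liminf integrability conditions at `0`. -/
def F3Hyp (f : ℝ → ℝ) (γ₁ : ℝ) : Prop :=
  Filter.liminf (fun ν => ∫⁻ t in Set.Ioo (0:ℝ) ν, ENNReal.ofReal (f t ^ (-1 / (γ₁ - 1))))
      (nhdsWithin 0 (Set.Ioi 0)) < ⊤ ∧
  Filter.liminf (fun ν => ∫⁻ t in Set.Ioo ν (0:ℝ), ENNReal.ofReal ((-f t) ^ (-1 / (γ₁ - 1))))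
      (nhdsWithin 0 (Set.Iio 0)) < ⊤

/-- `u` (with derivative `u'`) is a solution of the initial value problem `(P_{λ,d})` on the
interval `I ⊆ [0,∞)` (with `0 ∈ I`): `u` is `C¹` on `I`, `u(0) = d`, `u'(0) = 0`,
`r ↦ r^α φ(|u'(r)|) u'(r)` is differentiable on `I ∩ (0,∞)` and
`-(r^α φ(|u'(r)|) u'(r))' = λ r^γ f(u(r))` there. -/
def IsSolOn (φ f : ℝ → ℝ) (α γ lam d : ℝ) (I : Set ℝ) (u u' : ℝ → ℝ) : Prop :=
  u 0 = d ∧ u' 0 = 0 ∧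
  (∀ r ∈ I, HasDerivWithinAt u (u' r) I r) ∧
  ContinuousOn u' I ∧
  ∀ r ∈ I ∩ Set.Ioi 0,
    HasDerivWithinAt (fun s => s ^ α * (φ |u' s| * u' s))
      (-(lam * r ^ γ * f (u r))) (I ∩ Set.Ioi 0) r

/-- `u` (with derivative `u'`) is a solution of the boundary value problem `(P_λ)` on `[0,R]`:
`u` is `C¹` on `[0,R]`, `u'(0) = 0`, `u(R) = 0`, `r ↦ r^α φ(|u'(r)|) u'(r)` is differentiable
on `(0,R)` and `-(r^α φ(|u'(r)|) u'(r))' = λ r^γ f(u(r))` for `0 < r < R`. -/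
def IsBVPSol (φ f : ℝ → ℝ) (α γ lam R : ℝ) (u u' : ℝ → ℝ) : Prop :=
  u' 0 = 0 ∧ u R = 0 ∧
  (∀ r ∈ Set.Icc 0 R, HasDerivWithinAt u (u' r) (Set.Icc 0 R) r) ∧
  ContinuousOn u' (Set.Icc 0 R) ∧
  ∀ r ∈ Set.Ioo 0 R,
    HasDerivWithinAt (fun s => s ^ α * (φ |u' s| * u' s))
      (-(lam * r ^ γ * f (u r))) (Set.Ioo 0 R) r

/-- `Φ(t) = ∫₀ᵗ s φ(s) ds`. -/
def PhiFun (φ : ℝ → ℝ) (t : ℝ) : ℝ := ∫ s in (0:ℝ)..t, s * φ s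

/-- `H(t) = t Φ'(t) - Φ(t)` where `Φ'(t) = t φ(t)` for `t > 0` (and `H(0) = 0`). -/
def Hfun (φ : ℝ → ℝ) (t : ℝ) : ℝ := t * (t * φ t) - PhiFun φ t

/-- `F(t) = ∫₀ᵗ f(s) ds`. -/
def Fint (f : ℝ → ℝ) (t : ℝ) : ℝ := ∫ s in (0:ℝ)..t, f s

/-- `z : ℕ → ℝ` (indexed from `0`, representing `z₁ < z₂ < ⋯`) is the strictly increasing
sequence of all positive zeroes of `u`: `u` vanishes at each `z ℓ` and vanishes nowhere else
in `(0, ∞)` below `z 0` or between consecutive terms. -/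
def IsZeroSeq (u : ℝ → ℝ) (z : ℕ → ℝ) : Prop :=
  StrictMono z ∧ 0 < z 0 ∧ (∀ ℓ, u (z ℓ) = 0) ∧
  (∀ r : ℝ, 0 < r → r < z 0 → u r ≠ 0) ∧
  ∀ ℓ : ℕ, ∀ r : ℝ, z ℓ < r → r < z (ℓ + 1) → u r ≠ 0

/-- `z` is the first (smallest) positive zero of `u`. -/
def IsFirstZero (u : ℝ → ℝ) (z : ℝ) : Prop :=
  0 < z ∧ u z = 0 ∧ ∀ r : ℝ, 0 < r → r < z → u r ≠ 0

namespace Shooting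

/-- Standing assumptions on the first order system
`u' = g (r ^ (-α) * v)`, `v' = -(lam * (r ^ γ * f u))`. -/
structure Data (g f : ℝ → ℝ) (p α γ lam R M : ℝ) : Prop where
  g_cont : Continuous g
  g_mono : StrictMono g
  g_odd : ∀ x, g (-x) = -g x
  p_pos : 0 < p
  g_scale : ∀ k, 1 ≤ k → ∀ x, 0 < x → g (k * x) ≤ k ^ p * g x
  f_cont : Continuous f
  f_mono : Monotone f
  f_sign : ∀ t, t ≠ 0 → 0 < t * f t
  f_bdd : ∀ t, |f t| ≤ M
  f_lip : ∀ t, t ≠ 0 → ∃ L, 0 ≤ L ∧ ∃ ε, 0 < ε ∧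
    ∀ x y, |x - t| < ε → |y - t| < ε → |f x - f y| ≤ L * |x - y|
  lam_pos : 0 < lam
  R_pos : 0 < R
  le_gam : α ≤ γ
  le_gam' : -α * p ≤ γ

/-- The flux `r ^ α * φ(|u'|) u'` of a solution `u`. -/
def flux (f : ℝ → ℝ) (γ lam : ℝ) (u : ℝ → ℝ) (r : ℝ) : ℝ :=
  -(lam * ∫ t in (0 : ℝ)..r, t ^ γ * f (u t))

/-- The flux divided by `r ^ α`. -/
def wflux (f : ℝ → ℝ) (α γ lam : ℝ) (u : ℝ → ℝ) (r : ℝ) : ℝ :=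
  r ^ (-α) * flux f γ lam u r

/-- The integral operator whose fixed points are the solutions of the initial value problem. -/
def picard (g f : ℝ → ℝ) (α γ lam d : ℝ) (u : ℝ → ℝ) (r : ℝ) : ℝ :=
  d + ∫ s in (0 : ℝ)..r, g (wflux f α γ lam u s)

/-- A solution on `[0, R]` of the initial value problem `u 0 = d`, in integral form. -/
structure IsSol (g f : ℝ → ℝ) (α γ lam R d : ℝ) (u : ℝ → ℝ) : Prop where
  cont : Continuous u
  eq : ∀ r ∈ Icc 0 R, u r = picard g f α γ lam d u r

variable {g f : ℝ → ℝ} {p α γ lam R M d : ℝ} {u : ℝ → ℝ}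

section basics

theorem Data.gam_nonneg (D : Data g f p α γ lam R M) : 0 ≤ γ := by
  rcases le_total 0 α with h | h
  · exact h.trans D.le_gam
  · exact (mul_nonneg (neg_nonneg.2 h) D.p_pos.le).trans D.le_gam'

theorem Data.exp_pos (D : Data g f p α γ lam R M) : 0 < γ + 1 - α := by
  linarith [D.le_gam]

theorem Data.g_zero (D : Data g f p α γ lam R M) : g 0 = 0 := by
  have := D.g_odd 0
  simp at this
  linarith

theorem Data.g_pos (D : Data g f p α γ lam R M) {x : ℝ} (hx : 0 < x) : 0 < g x := by
  have := D.g_mono hx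
  rwa [D.g_zero] at this

theorem Data.f_pos (D : Data g f p α γ lam R M) {x : ℝ} (hx : 0 < x) : 0 < f x :=
  (mul_pos_iff_of_pos_left hx).1 (D.f_sign x hx.ne')

theorem Data.f_neg (D : Data g f p α γ lam R M) {x : ℝ} (hx : x < 0) : f x < 0 := by
  have := D.f_sign x hx.ne
  by_contra! h
  nlinarith

theorem Data.M_pos (D : Data g f p α γ lam R M) : 0 < M :=
  ((D.f_pos one_pos).trans_le (le_abs_self _)).trans_le (D.f_bdd 1)

theorem Data.abs_g_le (D : Data g f p α γ lam R M) {x B : ℝ} (h : |x| ≤ B) : |g x| ≤ g B := by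
  rw [abs_le] at h ⊢
  rw [← D.g_odd]
  exact ⟨D.g_mono.monotone (by linarith), D.g_mono.monotone h.2⟩

theorem Data.symm (D : Data g f p α γ lam R M) :
    Data g (fun x => -f (-x)) p α γ lam R M where
  g_cont := D.g_cont
  g_mono := D.g_mono
  g_odd := D.g_odd
  p_pos := D.p_pos
  g_scale := D.g_scale
  f_cont := (D.f_cont.comp continuous_neg).neg
  f_mono := fun x y h => neg_le_neg (D.f_mono (neg_le_neg h))
  f_sign := fun t ht => by
    have := D.f_sign (-t) (neg_ne_zero.2 ht)
    linarith
  f_bdd := fun t => by rw [abs_neg]; exact D.f_bdd _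
  f_lip := fun t ht => by
    obtain ⟨L, hL, ε, hε, h⟩ := D.f_lip (-t) (neg_ne_zero.2 ht)
    refine ⟨L, hL, ε, hε, fun x y hx hy => ?_⟩
    have := h (-x) (-y) (by rwa [← abs_neg, show -(-x - -t) = x - t by ring])
      (by rwa [← abs_neg, show -(-y - -t) = y - t by ring])
    rw [show -f (-x) - -f (-y) = -(f (-x) - f (-y)) by ring, abs_neg]
    rwa [show -x - -y = -(x - y) by ring, abs_neg] at this
  lam_pos := D.lam_pos
  R_pos := D.R_pos
  le_gam := D.le_gam
  le_gam' := D.le_gam'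

theorem Data.continuous_integrand (D : Data g f p α γ lam R M) (hu : Continuous u) :
    Continuous fun t : ℝ => t ^ γ * f (u t) :=
  (Real.continuous_rpow_const D.gam_nonneg).mul (D.f_cont.comp hu)

theorem Data.hasDerivAt_flux (D : Data g f p α γ lam R M) (hu : Continuous u) (r : ℝ) :
    HasDerivAt (flux f γ lam u) (-(lam * (r ^ γ * f (u r)))) r :=
  (((D.continuous_integrand hu).integral_hasStrictDerivAt 0 r).hasDerivAt.const_mul lam).neg

theorem Data.continuous_flux (D : Data g f p α γ lam R M) (hu : Continuous u) :
    Continuous (flux f γ lam u) :=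
  continuous_iff_continuousAt.2 fun r => (D.hasDerivAt_flux hu r).continuousAt

@[simp] theorem flux_zero : flux f γ lam u 0 = 0 := by simp [flux]

@[simp] theorem wflux_zero : wflux f α γ lam u 0 = 0 := by simp [wflux]

theorem Data.abs_wflux_le (D : Data g f p α γ lam R M) (u : ℝ → ℝ) (r : ℝ) :
    |wflux f α γ lam u r| ≤ lam * M * |r| ^ (γ + 1 - α) := by
  have hM := D.M_pos
  have hl := D.lam_pos
  rcases eq_or_ne r 0 with rfl | hr
  · simp only [wflux_zero, abs_zero]
    positivity
  have hr' : 0 < |r| := abs_pos.2 hr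
  have h1 : ‖∫ t in (0 : ℝ)..r, t ^ γ * f (u t)‖ ≤ |r| ^ γ * M * |r - 0| := by
    refine intervalIntegral.norm_integral_le_of_norm_le_const fun t ht => ?_
    have htr : |t| ≤ |r| := by
      rcases mem_uIoc.1 ht with h | h
      · rw [abs_of_pos h.1]; exact h.2.trans (le_abs_self _)
      · rw [abs_of_nonpos h.2, abs_of_neg (h.1.trans_le h.2)]; linarith
    rw [norm_mul, Real.norm_eq_abs, Real.norm_eq_abs]
    refine mul_le_mul ?_ (D.f_bdd _) (abs_nonneg _) (by positivity)
    exact (Real.abs_rpow_le_abs_rpow t γ).trans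
      (Real.rpow_le_rpow (abs_nonneg _) htr D.gam_nonneg)
  have h2 : |r| ^ (γ + 1 - α) = |r| ^ (-α) * (|r| ^ γ * |r|) := by
    rw [show γ + 1 - α = -α + (γ + 1) by ring, Real.rpow_add hr', Real.rpow_add hr',
      Real.rpow_one]
  rw [wflux, flux, abs_mul, abs_neg, abs_mul, abs_of_pos hl, h2]
  rw [sub_zero, Real.norm_eq_abs] at h1
  calc |r ^ (-α)| * (lam * |∫ t in (0 : ℝ)..r, t ^ γ * f (u t)|)
      ≤ |r| ^ (-α) * (lam * (|r| ^ γ * M * |r|)) :=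
        mul_le_mul (Real.abs_rpow_le_abs_rpow _ _)
          (mul_le_mul_of_nonneg_left h1 hl.le) (by positivity) (by positivity)
    _ = _ := by ring

theorem Data.abs_wflux_le_of_mem (D : Data g f p α γ lam R M) (u : ℝ → ℝ) {r : ℝ}
    (hr : r ∈ Icc 0 R) : |wflux f α γ lam u r| ≤ lam * M * R ^ (γ + 1 - α) := by
  refine (D.abs_wflux_le u r).trans ?_
  have := mul_pos D.lam_pos D.M_pos
  rw [abs_of_nonneg hr.1]
  gcongr
  exacts [hr.1, D.exp_pos.le, hr.2]

theorem Data.continuous_wflux (D : Data g f p α γ lam R M) (hu : Continuous u) :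
    Continuous (wflux f α γ lam u) := by
  rw [continuous_iff_continuousAt]
  intro r
  rcases eq_or_ne r 0 with rfl | hr
  · rw [ContinuousAt, wflux_zero]
    have h0 : Tendsto (fun r : ℝ => lam * M * |r| ^ (γ + 1 - α)) (𝓝 0) (𝓝 0) := by
      have : Continuous fun r : ℝ => lam * M * |r| ^ (γ + 1 - α) :=
        continuous_const.mul ((Real.continuous_rpow_const D.exp_pos.le).comp continuous_abs)
      have h := this.tendsto 0
      simpa [Real.zero_rpow D.exp_pos.ne'] using h
    exact squeeze_zero_norm (D.abs_wflux_le u) h0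
  · exact (Real.continuousAt_rpow_const r _ (Or.inl hr)).mul (D.continuous_flux hu).continuousAt

theorem Data.continuous_slope (D : Data g f p α γ lam R M) (hu : Continuous u) :
    Continuous fun r => g (wflux f α γ lam u r) :=
  D.g_cont.comp (D.continuous_wflux hu)

theorem Data.hasDerivAt_picard (D : Data g f p α γ lam R M) (hu : Continuous u) (d r : ℝ) :
    HasDerivAt (picard g f α γ lam d u) (g (wflux f α γ lam u r)) r :=
  ((D.continuous_slope hu).integral_hasStrictDerivAt 0 r).hasDerivAt.const_add d

theorem Data.continuous_picard (D : Data g f p α γ lam R M) (hu : Continuous u) (d : ℝ) :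
    Continuous (picard g f α γ lam d u) :=
  continuous_iff_continuousAt.2 fun r => (D.hasDerivAt_picard hu d r).continuousAt

@[simp] theorem picard_zero : picard g f α γ lam d u 0 = d := by simp [picard]

theorem Data.abs_picard_sub_le (D : Data g f p α γ lam R M) (hu : Continuous u) (d : ℝ)
    {x y : ℝ} (hx : x ∈ Icc 0 R) (hy : y ∈ Icc 0 R) :
    |picard g f α γ lam d u x - picard g f α γ lam d u y| ≤
      g (lam * M * R ^ (γ + 1 - α)) * |x - y| :=
  (convex_Icc 0 R).norm_image_sub_le_of_norm_hasDerivWithin_le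
    (fun r _ => (D.hasDerivAt_picard hu d r).hasDerivWithinAt)
    (fun _ hr => D.abs_g_le (D.abs_wflux_le_of_mem u hr)) hy hx

theorem flux_congr {u₁ u₂ : ℝ → ℝ} {r : ℝ} (hr : 0 ≤ r) (h : ∀ t ∈ Icc 0 r, u₁ t = u₂ t) :
    flux f γ lam u₁ r = flux f γ lam u₂ r := by
  rw [flux, flux]
  congr 2
  refine intervalIntegral.integral_congr fun t ht => ?_
  rw [uIcc_of_le hr] at ht
  simp only [h t ht]

theorem wflux_congr {u₁ u₂ : ℝ → ℝ} {r : ℝ} (hr : 0 ≤ r) (h : ∀ t ∈ Icc 0 r, u₁ t = u₂ t) :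
    wflux f α γ lam u₁ r = wflux f α γ lam u₂ r := by
  rw [wflux, wflux, flux_congr hr h]

theorem picard_congr {u₁ u₂ : ℝ → ℝ} {r : ℝ} (hr : 0 ≤ r) (h : ∀ t ∈ Icc 0 r, u₁ t = u₂ t) :
    picard g f α γ lam d u₁ r = picard g f α γ lam d u₂ r := by
  rw [picard, picard]
  congr 1
  refine intervalIntegral.integral_congr fun s hs => ?_
  rw [uIcc_of_le hr] at hs
  simp only [wflux_congr hs.1 fun t ht => h t ⟨ht.1, ht.2.trans hs.2⟩]

theorem IsSol.zero (S : IsSol g f α γ lam R d u) (hR : 0 ≤ R) : u 0 = d := by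
  rw [S.eq 0 ⟨le_rfl, hR⟩, picard_zero]

theorem IsSol.hasDerivWithinAt (D : Data g f p α γ lam R M) (S : IsSol g f α γ lam R d u)
    {r : ℝ} (hr : r ∈ Icc 0 R) :
    HasDerivWithinAt u (g (wflux f α γ lam u r)) (Icc 0 R) r :=
  (D.hasDerivAt_picard S.cont d r).hasDerivWithinAt.congr S.eq (S.eq r hr)

theorem IsSol.hasDerivAt (D : Data g f p α γ lam R M) (S : IsSol g f α γ lam R d u)
    {r : ℝ} (hr : r ∈ Ioo 0 R) :
    HasDerivAt u (g (wflux f α γ lam u r)) r :=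
  (S.hasDerivWithinAt D ⟨hr.1.le, hr.2.le⟩).hasDerivAt (Icc_mem_nhds hr.1 hr.2)

theorem Data.hasDerivAt_wflux (D : Data g f p α γ lam R M) (hu : Continuous u) {r : ℝ}
    (hr : 0 < r) : HasDerivAt (wflux f α γ lam u)
      (-α * (wflux f α γ lam u r / r) - lam * (r ^ (γ - α) * f (u r))) r := by
  have h := (Real.hasDerivAt_rpow_const (p := -α) (Or.inl hr.ne')).mul (D.hasDerivAt_flux hu r)
  refine h.congr_deriv ?_
  rw [wflux, Real.rpow_sub_one hr.ne', sub_eq_add_neg γ α, Real.rpow_add hr]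
  ring

theorem Data.wflux_eq_zero_iff (D : Data g f p α γ lam R M) {r : ℝ} (hr : 0 < r) :
    g (wflux f α γ lam u r) = 0 ↔ flux f γ lam u r = 0 := by
  rw [D.g_mono.injective.eq_iff' D.g_zero, wflux, mul_eq_zero]
  exact or_iff_right (Real.rpow_pos_of_pos hr _).ne'

end basics

section compactness

theorem Data.abs_flux_sub_le (D : Data g f p α γ lam R M) (hu : Continuous u)
    {x y : ℝ} (hx : x ∈ Icc 0 R) (hy : y ∈ Icc 0 R) :
    |flux f γ lam u x - flux f γ lam u y| ≤ lam * (R ^ γ * M) * |x - y| := by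
  refine (convex_Icc 0 R).norm_image_sub_le_of_norm_hasDerivWithin_le
    (fun r _ => (D.hasDerivAt_flux hu r).hasDerivWithinAt) (fun r hr => ?_) hy hx
  rw [Real.norm_eq_abs, abs_neg, abs_mul, abs_of_pos D.lam_pos, abs_mul,
    abs_of_nonneg (Real.rpow_nonneg hr.1 γ)]
  refine mul_le_mul_of_nonneg_left ?_ D.lam_pos.le
  exact mul_le_mul (Real.rpow_le_rpow hr.1 hr.2 D.gam_nonneg) (D.f_bdd _) (abs_nonneg _)
    (Real.rpow_nonneg D.R_pos.le _)

theorem Data.tendsto_flux (D : Data g f p α γ lam R M) {v : ℕ → ℝ → ℝ}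
    (hv : ∀ n, Continuous (v n)) (h : ∀ t ∈ Icc 0 R, Tendsto (fun n => v n t) atTop (𝓝 (u t)))
    {r : ℝ} (hr : r ∈ Icc 0 R) :
    Tendsto (fun n => flux f γ lam (v n) r) atTop (𝓝 (flux f γ lam u r)) := by
  refine (Tendsto.const_mul lam ?_).neg
  refine intervalIntegral.tendsto_integral_filter_of_dominated_convergence
    (fun _ => R ^ γ * M) ?_ ?_ intervalIntegrable_const ?_
  · exact Eventually.of_forall fun n => (D.continuous_integrand (hv n)).aestronglyMeasurable
  · refine Eventually.of_forall fun n => Eventually.of_forall fun t ht => ?_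
    rw [uIoc_of_le hr.1] at ht
    rw [norm_mul, Real.norm_eq_abs, Real.norm_eq_abs, abs_of_nonneg (Real.rpow_nonneg ht.1.le γ)]
    exact mul_le_mul (Real.rpow_le_rpow ht.1.le (ht.2.trans hr.2) D.gam_nonneg) (D.f_bdd _)
      (abs_nonneg _) (Real.rpow_nonneg D.R_pos.le _)
  · refine Eventually.of_forall fun t ht => ?_
    rw [uIoc_of_le hr.1] at ht
    exact ((D.f_cont.tendsto _).comp (h t ⟨ht.1.le, ht.2.trans hr.2⟩)).const_mul _

theorem Data.tendsto_picard (D : Data g f p α γ lam R M) {v : ℕ → ℝ → ℝ} {e : ℕ → ℝ}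
    (he : Tendsto e atTop (𝓝 d))
    (hv : ∀ n, Continuous (v n)) (h : ∀ t ∈ Icc 0 R, Tendsto (fun n => v n t) atTop (𝓝 (u t)))
    {r : ℝ} (hr : r ∈ Icc 0 R) :
    Tendsto (fun n => picard g f α γ lam (e n) (v n) r) atTop (𝓝 (picard g f α γ lam d u r)) := by
  refine he.add ?_
  have hsub : ∀ s ∈ uIoc 0 r, s ∈ Icc 0 R := fun s hs => by
    rw [uIoc_of_le hr.1] at hs
    exact ⟨hs.1.le, hs.2.trans hr.2⟩
  refine intervalIntegral.tendsto_integral_filter_of_dominated_convergence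
    (fun _ => g (lam * M * R ^ (γ + 1 - α))) ?_ ?_ intervalIntegrable_const ?_
  · exact Eventually.of_forall fun n => (D.continuous_slope (hv n)).aestronglyMeasurable
  · exact Eventually.of_forall fun n => Eventually.of_forall fun s hs =>
      D.abs_g_le (D.abs_wflux_le_of_mem _ (hsub s hs))
  · exact Eventually.of_forall fun s hs =>
      (D.g_cont.tendsto _).comp ((D.tendsto_flux hv h (hsub s hs)).const_mul _)

/-- Solutions of delayed problems with delays tending to `0` subconverge to a solution. -/
theorem Data.exists_subseq (D : Data g f p α γ lam R M) {δ e : ℕ → ℝ}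
    (hδ0 : ∀ n, 0 ≤ δ n) (hδ : Tendsto δ atTop (𝓝 0)) (he : Tendsto e atTop (𝓝 d))
    {w : ℕ → ℝ → ℝ} (hw : ∀ n, Continuous (w n))
    (h : ∀ n, ∀ r ∈ Icc 0 R,
      w n r = picard g f α γ lam (e n) (fun t => w n (max (t - δ n) 0)) r) :
    ∃ u, IsSol g f α γ lam R d u ∧ ∃ ns : ℕ → ℕ, StrictMono ns ∧
      TendstoUniformlyOn (fun k => w (ns k)) u atTop (Icc 0 R) := by
  have hR := D.R_pos
  set L := g (lam * M * R ^ (γ + 1 - α)) with hL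
  have hLpos : 0 ≤ L :=
    (D.g_pos (mul_pos (mul_pos D.lam_pos D.M_pos) (Real.rpow_pos_of_pos hR _))).le
  have hcont : ∀ n, Continuous fun t => w n (max (t - δ n) 0) := fun n =>
    (hw n).comp ((continuous_id.sub continuous_const).max continuous_const)
  have hlip : ∀ n, ∀ x ∈ Icc 0 R, ∀ y ∈ Icc 0 R, |w n x - w n y| ≤ L * |x - y| := by
    intro n x hx y hy
    rw [h n x hx, h n y hy]
    exact D.abs_picard_sub_le (hcont n) _ hx hy
  have h0 : ∀ n, w n 0 = e n := fun n => by rw [h n 0 ⟨le_rfl, hR.le⟩, picard_zero]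
  obtain ⟨K, hK⟩ := he.bddAbove_range
  obtain ⟨K', hK'⟩ := he.bddBelow_range
  let A : ℕ → BoundedContinuousFunction (Icc (0 : ℝ) R) ℝ := fun n =>
    BoundedContinuousFunction.mkOfCompact ⟨(Icc 0 R).domRestrict (w n), (hw n).continuousOn.domRestrict⟩
  have hA : ∀ n (x : Icc (0 : ℝ) R), A n x = w n x := fun n x => rfl
  have hcomp : IsCompact (closure (range A)) := by
    refine BoundedContinuousFunction.arzela_ascoli (Icc (K' - L * R) (K + L * R))
      isCompact_Icc _ ?_ ?_
    · rintro _ x ⟨n, rfl⟩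
      rw [hA]
      have h1 := hlip n x x.2 0 ⟨le_rfl, hR.le⟩
      have h2 : L * |(x : ℝ) - 0| ≤ L * R := by
        rw [sub_zero, abs_of_nonneg x.2.1]
        exact mul_le_mul_of_nonneg_left x.2.2 hLpos
      rw [h0] at h1
      have h3 := abs_le.1 (h1.trans h2)
      have h4 := hK (mem_range_self n)
      have h5 := hK' (mem_range_self n)
      constructor <;> linarith
    · refine (LipschitzWith.uniformEquicontinuous _ L.toNNReal ?_).equicontinuous
      rintro ⟨_, n, rfl⟩
      refine LipschitzWith.of_dist_le_mul fun x y => ?_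
      rw [Real.coe_toNNReal _ hLpos]
      exact hlip n x x.2 y y.2
  obtain ⟨a, -, ns, hns, hlim⟩ :=
    hcomp.tendsto_subseq fun n => subset_closure (mem_range_self n)
  rw [BoundedContinuousFunction.tendsto_iff_tendstoUniformly] at hlim
  let u : ℝ → ℝ := IccExtend hR.le a
  have hu : ∀ x (hx : x ∈ Icc 0 R), u x = a ⟨x, hx⟩ := fun x hx => IccExtend_of_mem _ _ hx
  have hunif : TendstoUniformlyOn (fun k => w (ns k)) u atTop (Icc 0 R) := by
    rw [tendstoUniformlyOn_iff_tendstoUniformly_comp_coe]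
    rw [show u ∘ ((↑) : Icc (0 : ℝ) R → ℝ) = a from funext fun x => hu x x.2]
    exact hlim
  have hpt : ∀ t ∈ Icc 0 R, Tendsto (fun k => w (ns k) t) atTop (𝓝 (u t)) := fun t ht =>
    hunif.tendsto_at ht
  refine ⟨u, ⟨a.continuous.Icc_extend', fun r hr => ?_⟩, ns, hns, hunif⟩
  have hpt' : ∀ t ∈ Icc 0 R,
      Tendsto (fun k => w (ns k) (max (t - δ (ns k)) 0)) atTop (𝓝 (u t)) := by
    intro t ht
    have hm : ∀ k, max (t - δ (ns k)) 0 ∈ Icc 0 R := fun k =>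
      ⟨le_max_right _ _, max_le (by linarith [hδ0 (ns k), ht.2]) hR.le⟩
    have h1 : Tendsto (fun k => L * |max (t - δ (ns k)) 0 - t|) atTop (𝓝 0) := by
      have : Tendsto (fun k => L * |max (t - δ (ns k)) 0 - t|) atTop
          (𝓝 (L * |max (t - 0) 0 - t|)) :=
        ((((hδ.comp hns.tendsto_atTop).const_sub t).max tendsto_const_nhds).sub_const t).abs.const_mul
          L
      simpa [max_eq_left ht.1] using this
    have h2 := squeeze_zero_norm
      (f := fun k => w (ns k) (max (t - δ (ns k)) 0) - w (ns k) t)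
      (fun k => hlip (ns k) _ (hm k) t ht) h1
    simpa using h2.add (hpt t ht)
  refine tendsto_nhds_unique (hpt r hr) ?_
  have := D.tendsto_picard (he.comp hns.tendsto_atTop) (fun k => hcont (ns k)) hpt' hr
  exact this.congr fun k => (h (ns k) r hr).symm

/-- **Peano existence** for the singular initial value problem, by Tonelli's method. -/
theorem Data.exists_isSol (D : Data g f p α γ lam R M) (d : ℝ) :
    ∃ u, IsSol g f α γ lam R d u := by
  have hR := D.R_pos
  let T : ℝ → (ℝ → ℝ) → ℝ → ℝ := fun δ u =>
    picard g f α γ lam d fun t => u (max (t - δ) 0)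
  have hTc : ∀ δ u, Continuous u → Continuous (T δ u) := fun δ u hu =>
    D.continuous_picard (hu.comp ((continuous_id.sub continuous_const).max continuous_const)) d
  have hTi : ∀ δ k, Continuous ((T δ)^[k] fun _ => d) := by
    intro δ k
    induction k with
    | zero => exact continuous_const
    | succ k ih => rw [Function.iterate_succ_apply']; exact hTc _ _ ih
  have hfix : ∀ δ : ℝ, 0 ≤ δ → ∀ k : ℕ, ∀ r ∈ Icc (0 : ℝ) (k * δ),
      (T δ)^[k + 1] (fun _ => d) r = (T δ)^[k] (fun _ => d) r := by
    intro δ hδ k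
    induction k with
    | zero =>
      intro r hr
      obtain rfl : r = 0 := by simpa using hr
      simp [T]
    | succ k ih =>
      intro r hr
      rw [Function.iterate_succ_apply' _ (k + 1), Function.iterate_succ_apply' _ k]
      refine picard_congr hr.1 fun t ht => ?_
      have h1 := ht.2.trans hr.2
      push_cast at h1
      have h2 := ih (max (t - δ) 0) ⟨le_max_right _ _, max_le (by linarith) (by positivity)⟩
      rwa [Function.iterate_succ_apply'] at h2
  have hδ : Tendsto (fun n : ℕ => R / ((n : ℝ) + 1)) atTop (𝓝 0) :=
    tendsto_const_div_atTop_nhds_zero_nat R |>.comp (tendsto_add_atTop_nat 1) |>.congr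
      fun n => by simp
  obtain ⟨u, hu, -⟩ := D.exists_subseq (e := fun _ => d)
    (w := fun n => (T (R / ((n : ℝ) + 1)))^[n + 1] fun _ => d)
    (fun n => by positivity) hδ tendsto_const_nhds (fun n => hTi _ _) (by
      intro n r hr
      rw [← hfix _ (by positivity) (n + 1) r (by
        push_cast
        rwa [mul_div_cancel₀ _ (by positivity : (n : ℝ) + 1 ≠ 0)])]
      rw [Function.iterate_succ_apply' _ (n + 1)])
  exact ⟨u, hu⟩

theorem Data.exists_subseq_isSol (D : Data g f p α γ lam R M) {e : ℕ → ℝ}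
    (he : Tendsto e atTop (𝓝 d)) {w : ℕ → ℝ → ℝ} (hw : ∀ n, IsSol g f α γ lam R (e n) (w n)) :
    ∃ u, IsSol g f α γ lam R d u ∧ ∃ ns : ℕ → ℕ, StrictMono ns ∧
      TendstoUniformlyOn (fun k => w (ns k)) u atTop (Icc 0 R) :=
  D.exists_subseq (fun _ => le_rfl) tendsto_const_nhds he (fun n => (hw n).cont) fun n r hr =>
    ((hw n).eq r hr).trans <| picard_congr hr.1 fun t ht => by rw [sub_zero, max_eq_left ht.1]

end compactness

section energy

/-- The primitive vanishing at `0`. -/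
def prim (h : ℝ → ℝ) (x : ℝ) : ℝ := ∫ t in (0 : ℝ)..x, h t

@[simp] theorem prim_zero (h : ℝ → ℝ) : prim h 0 = 0 := by simp [prim]

theorem hasDerivAt_prim {h : ℝ → ℝ} (hh : Continuous h) (x : ℝ) : HasDerivAt (prim h) (h x) x :=
  (hh.integral_hasStrictDerivAt 0 x).hasDerivAt

theorem continuous_prim {h : ℝ → ℝ} (hh : Continuous h) : Continuous (prim h) :=
  continuous_iff_continuousAt.2 fun x => (hasDerivAt_prim hh x).continuousAt

theorem Data.prim_f_strictMonoOn (D : Data g f p α γ lam R M) :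
    StrictMonoOn (prim f) (Ici 0) :=
  strictMonoOn_of_hasDerivWithinAt_pos (convex_Ici 0) (continuous_prim D.f_cont).continuousOn
    (fun x _ => (hasDerivAt_prim D.f_cont x).hasDerivWithinAt)
    fun x hx => D.f_pos (by simpa using hx)

theorem Data.prim_f_strictAntiOn (D : Data g f p α γ lam R M) :
    StrictAntiOn (prim f) (Iic 0) :=
  strictAntiOn_of_hasDerivWithinAt_neg (convex_Iic 0) (continuous_prim D.f_cont).continuousOn
    (fun x _ => (hasDerivAt_prim D.f_cont x).hasDerivWithinAt)
    fun x hx => D.f_neg (by simpa using hx)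

theorem Data.prim_f_pos (D : Data g f p α γ lam R M) {x : ℝ} (hx : x ≠ 0) : 0 < prim f x := by
  rcases hx.lt_or_gt with h | h
  · simpa using D.prim_f_strictAntiOn h.le (mem_Iic.2 le_rfl) h
  · simpa using D.prim_f_strictMonoOn (mem_Ici.2 le_rfl) h.le h

theorem Data.prim_f_nonneg (D : Data g f p α γ lam R M) (x : ℝ) : 0 ≤ prim f x := by
  rcases eq_or_ne x 0 with rfl | h
  · simp
  · exact (D.prim_f_pos h).le

theorem Data.prim_g_neg (D : Data g f p α γ lam R M) (x : ℝ) : prim g (-x) = prim g x := by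
  have h := intervalIntegral.integral_comp_neg (a := 0) (b := x) g
  simp only [D.g_odd, intervalIntegral.integral_neg, neg_zero] at h
  rw [prim, prim, intervalIntegral.integral_symm, ← h, neg_neg]

theorem Data.prim_g_bounds_of_pos (D : Data g f p α γ lam R M) {x : ℝ} (hx : 0 < x) :
    prim g x ≤ x * g x ∧ x * g x ≤ (p + 1) * prim g x := by
  have hp := D.p_pos
  have hi : IntervalIntegrable g volume 0 x := D.g_cont.intervalIntegrable _ _
  constructor
  · have h := intervalIntegral.integral_mono_on hx.le hi intervalIntegrable_const
      (g := fun _ => g x) fun t ht => D.g_mono.monotone ht.2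
    simpa [prim] using h
  · have h := intervalIntegral.integral_mono_on (f := fun t => g x / x ^ p * t ^ p) hx.le
      ((intervalIntegral.intervalIntegrable_rpow' (by linarith)).const_mul _) hi fun t ht => by
        rcases ht.1.eq_or_lt with rfl | ht0
        · simp [Real.zero_rpow hp.ne', D.g_zero]
        · have h1 := D.g_scale (x / t) ((one_le_div ht0).2 ht.2) t ht0
          rw [div_mul_cancel₀ _ ht0.ne', Real.div_rpow hx.le ht0.le] at h1
          have h2 : 0 < x ^ p := Real.rpow_pos_of_pos hx _
          have h3 : 0 < t ^ p := Real.rpow_pos_of_pos ht0 _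
          rw [div_mul_eq_mul_div, div_le_iff₀ h2]
          rw [div_mul_eq_mul_div, le_div_iff₀ h3] at h1
          linarith
    rw [intervalIntegral.integral_const_mul, integral_rpow (Or.inl (by linarith)),
      Real.zero_rpow (by linarith), Real.rpow_add hx, Real.rpow_one, sub_zero] at h
    have h2 : 0 < x ^ p := Real.rpow_pos_of_pos hx _
    have h3 : g x / x ^ p * (x ^ p * x / (p + 1)) = x * g x / (p + 1) := by
      field_simp
    rw [h3, div_le_iff₀ (by linarith)] at h
    rw [prim]
    linarith

theorem Data.prim_g_bounds (D : Data g f p α γ lam R M) (x : ℝ) :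
    prim g x ≤ x * g x ∧ x * g x ≤ (p + 1) * prim g x := by
  rcases lt_trichotomy x 0 with h | rfl | h
  · have := D.prim_g_bounds_of_pos (neg_pos.2 h)
    rwa [D.prim_g_neg, D.g_odd, neg_mul_neg] at this
  · simp
  · exact D.prim_g_bounds_of_pos h

theorem Data.mul_g_nonneg (D : Data g f p α γ lam R M) (x : ℝ) : 0 ≤ x * g x := by
  rcases lt_trichotomy x 0 with h | rfl | h
  · have := D.g_pos (neg_pos.2 h)
    rw [D.g_odd] at this
    nlinarith
  · simp
  · exact (mul_pos h (D.g_pos h)).le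

theorem Data.prim_g_nonneg (D : Data g f p α γ lam R M) (x : ℝ) : 0 ≤ prim g x := by
  have h1 := (D.prim_g_bounds x).2
  have h2 := D.mul_g_nonneg x
  have := D.p_pos
  nlinarith

/-- The energy of a solution. -/
def energy (g f : ℝ → ℝ) (α γ lam : ℝ) (u : ℝ → ℝ) (r : ℝ) : ℝ :=
  r ^ (α - γ) * prim g (wflux f α γ lam u r) + lam * prim f (u r)

theorem Data.continuousOn_energy (D : Data g f p α γ lam R M) (hu : Continuous u) :
    ContinuousOn (energy g f α γ lam u) (Ioi 0) := by
  refine ContinuousOn.add (ContinuousOn.mul ?_ ?_) ?_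
  · exact fun r hr => (Real.continuousAt_rpow_const r _ (Or.inl (ne_of_gt hr))).continuousWithinAt
  · exact ((continuous_prim D.g_cont).comp (D.continuous_wflux hu)).continuousOn
  · exact (((continuous_prim D.f_cont).comp hu).const_mul _).continuousOn

theorem IsSol.hasDerivAt_energy (D : Data g f p α γ lam R M) (S : IsSol g f α γ lam R d u)
    {r : ℝ} (hr : r ∈ Ioo 0 R) :
    HasDerivAt (energy g f α γ lam u)
      (r ^ (α - γ - 1) * ((α - γ) * prim g (wflux f α γ lam u r)
        - α * (wflux f α γ lam u r * g (wflux f α γ lam u r)))) r := by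
  have h1 := Real.hasDerivAt_rpow_const (p := α - γ) (Or.inl hr.1.ne')
  have h2 := (hasDerivAt_prim D.g_cont _).comp r (D.hasDerivAt_wflux S.cont hr.1)
  have h3 := ((hasDerivAt_prim D.f_cont _).comp r (S.hasDerivAt D hr)).const_mul lam
  refine ((h1.mul h2).add h3).congr_deriv ?_
  have e1 : r ^ (α - γ) * r ^ (γ - α) = 1 := by
    rw [← Real.rpow_add hr.1]; simp
  have e2 : r ^ (α - γ) = r ^ (α - γ - 1) * r := by
    rw [Real.rpow_sub_one hr.1.ne', div_mul_cancel₀ _ hr.1.ne']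
  simp only [Function.comp]
  set W := wflux f α γ lam u r
  have e3 : r ^ (α - γ) * (g W * (-α * (W / r) - lam * (r ^ (γ - α) * f (u r))))
      = -(α * r ^ (α - γ) / r * (W * g W))
        - lam * (f (u r) * g W) * (r ^ (α - γ) * r ^ (γ - α)) := by ring
  have hr0 := hr.1.ne'
  rw [e3, e1, e2]
  field_simp
  ring

theorem IsSol.antitoneOn_energy (D : Data g f p α γ lam R M) (S : IsSol g f α γ lam R d u) :
    AntitoneOn (energy g f α γ lam u) (Ioc 0 R) := by
  refine antitoneOn_of_hasDerivWithinAt_nonpos (convex_Ioc 0 R)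
    ((D.continuousOn_energy S.cont).mono fun r hr => hr.1)
    (fun r hr => (S.hasDerivAt_energy D (by rwa [interior_Ioc] at hr)).hasDerivWithinAt)
    fun r hr => ?_
  rw [interior_Ioc] at hr
  refine mul_nonpos_of_nonneg_of_nonpos (Real.rpow_nonneg hr.1.le _) ?_
  set W := wflux f α γ lam u r
  have h1 := D.prim_g_nonneg W
  have h2 := D.mul_g_nonneg W
  have h3 := D.prim_g_bounds W
  have h4 := D.le_gam
  have h5 := D.le_gam'
  rcases le_total 0 α with h | h
  · nlinarith
  · nlinarith

theorem IsSol.monotoneOn_rpow_mul_energy (D : Data g f p α γ lam R M)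
    (S : IsSol g f α γ lam R d u) :
    MonotoneOn (fun r => r ^ (γ - α + |α| * (p + 1)) * energy g f α γ lam u r) (Ioc 0 R) := by
  have hp := D.p_pos
  have h4 := D.le_gam
  set K := γ - α + |α| * (p + 1) with hK
  have hK0 : 0 ≤ K := by
    have : 0 ≤ |α| * (p + 1) := by positivity
    linarith
  refine monotoneOn_of_hasDerivWithinAt_nonneg (convex_Ioc 0 R) ?_
    (fun r hr => ?_)
    (f' := fun r => K * r ^ (K - 1) * energy g f α γ lam u r +
      r ^ K * (r ^ (α - γ - 1) * ((α - γ) * prim g (wflux f α γ lam u r)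
        - α * (wflux f α γ lam u r * g (wflux f α γ lam u r)))))
    fun r hr => ?_
  · exact ContinuousOn.mul (Real.continuous_rpow_const hK0).continuousOn
      ((D.continuousOn_energy S.cont).mono fun r hr => hr.1)
  · rw [interior_Ioc] at hr
    exact ((Real.hasDerivAt_rpow_const (Or.inl hr.1.ne')).mul
      (S.hasDerivAt_energy D hr)).hasDerivWithinAt
  · rw [interior_Ioc] at hr
    rw [energy]
    set W := wflux f α γ lam u r
    have h1 := D.prim_g_nonneg W
    have h2 := D.mul_g_nonneg W
    have h3 := D.prim_g_bounds W
    have h5 := D.prim_f_nonneg (u r)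
    have e1 : r ^ (K - 1) * r ^ (α - γ) = r ^ (K + α - γ - 1) := by
      rw [← Real.rpow_add hr.1]; congr 1; ring
    have e2 : r ^ K * r ^ (α - γ - 1) = r ^ (K + α - γ - 1) := by
      rw [← Real.rpow_add hr.1]; congr 1; ring
    have e3 : K * r ^ (K - 1) * (r ^ (α - γ) * prim g W + lam * prim f (u r)) +
        r ^ K * (r ^ (α - γ - 1) * ((α - γ) * prim g W - α * (W * g W))) =
        r ^ (K + α - γ - 1) * (K * prim g W + (α - γ) * prim g W - α * (W * g W)) +
        K * r ^ (K - 1) * (lam * prim f (u r)) := by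
      rw [← mul_assoc (r ^ K), e2, mul_add, show K * r ^ (K - 1) * (r ^ (α - γ) * prim g W)
        = K * (r ^ (K - 1) * r ^ (α - γ)) * prim g W by ring, e1]
      ring
    rw [e3]
    have h6 : 0 ≤ K * prim g W + (α - γ) * prim g W - α * (W * g W) := by
      have : α * (W * g W) ≤ |α| * ((p + 1) * prim g W) :=
        mul_le_mul (le_abs_self α) h3.2 h2 (abs_nonneg α)
      rw [hK]
      linarith
    have h7 := Real.rpow_nonneg hr.1.le (K + α - γ - 1)
    have h8 := Real.rpow_nonneg hr.1.le (K - 1)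
    have := D.lam_pos
    positivity

theorem Data.rpow_mul_prim_g_le (D : Data g f p α γ lam R M) (u : ℝ → ℝ) {r : ℝ}
    (hr : r ∈ Ioc 0 R) :
    r ^ (α - γ) * prim g (wflux f α γ lam u r) ≤
      lam * M * g (lam * M * R ^ (γ + 1 - α)) * r := by
  have h1 := D.abs_wflux_le u r
  have h2 := D.abs_g_le (D.abs_wflux_le_of_mem u (Ioc_subset_Icc_self hr))
  have h3 := (D.prim_g_bounds (wflux f α γ lam u r)).1
  rw [abs_of_pos hr.1] at h1
  set W := wflux f α γ lam u r
  have h4 : W * g W ≤ lam * M * r ^ (γ + 1 - α) * g (lam * M * R ^ (γ + 1 - α)) :=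
    (le_abs_self _).trans <| (abs_mul _ _).trans_le <|
      mul_le_mul h1 h2 (abs_nonneg _) ((abs_nonneg _).trans h1)
  have e1 : r ^ (α - γ) * r ^ (γ + 1 - α) = r := by
    rw [← Real.rpow_add hr.1, show α - γ + (γ + 1 - α) = 1 by ring, Real.rpow_one]
  calc r ^ (α - γ) * prim g W
      ≤ r ^ (α - γ) * (lam * M * r ^ (γ + 1 - α) * g (lam * M * R ^ (γ + 1 - α))) :=
        mul_le_mul_of_nonneg_left (h3.trans h4) (Real.rpow_nonneg hr.1.le _)
    _ = lam * M * g (lam * M * R ^ (γ + 1 - α)) * (r ^ (α - γ) * r ^ (γ + 1 - α)) := by ring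
    _ = _ := by rw [e1]

theorem IsSol.prim_f_le (D : Data g f p α γ lam R M) (S : IsSol g f α γ lam R d u)
    {r : ℝ} (hr : r ∈ Icc 0 R) : prim f (u r) ≤ prim f d := by
  have hR := D.R_pos
  rcases hr.1.eq_or_lt with rfl | hr0
  · rw [S.zero hR.le]
  have h1 : ∀ s ∈ Ioo 0 r, lam * prim f (u r) ≤
      lam * M * g (lam * M * R ^ (γ + 1 - α)) * s + lam * prim f (u s) := by
    intro s hs
    have hs' : s ∈ Ioc 0 R := ⟨hs.1, hs.2.le.trans hr.2⟩
    have h2 := S.antitoneOn_energy D hs' ⟨hr0, hr.2⟩ hs.2.le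
    have h3 := D.rpow_mul_prim_g_le u hs'
    have h4 := mul_nonneg (Real.rpow_nonneg hr.1 (α - γ)) (D.prim_g_nonneg (wflux f α γ lam u r))
    simp only [energy] at h2
    linarith
  have h2 : Tendsto (fun s => lam * M * g (lam * M * R ^ (γ + 1 - α)) * s + lam * prim f (u s))
      (𝓝[>] 0) (𝓝 (lam * prim f d)) := by
    have hc : Continuous fun s =>
        lam * M * g (lam * M * R ^ (γ + 1 - α)) * s + lam * prim f (u s) :=
      (continuous_const.mul continuous_id).add (((continuous_prim D.f_cont).comp S.cont).const_mul _)
    have := (hc.tendsto 0).mono_left (nhdsWithin_le_nhds (s := Ioi 0))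
    simpa [S.zero hR.le] using this
  have h3 := ge_of_tendsto h2 (eventually_of_mem (Ioo_mem_nhdsGT hr0) h1)
  exact le_of_mul_le_mul_left h3 D.lam_pos

theorem IsSol.flux_ne_zero (D : Data g f p α γ lam R M) (S : IsSol g f α γ lam R d u)
    (hd : d ≠ 0) {r : ℝ} (hr : r ∈ Ioc 0 R) (hu : u r = 0) : flux f γ lam u r ≠ 0 := by
  intro hv
  have hR := D.R_pos
  have h1 : ∀ᶠ s in 𝓝[>] 0, u s ≠ 0 :=
    ((S.cont.continuousAt.eventually_ne (by rwa [S.zero hR.le]))).filter_mono nhdsWithin_le_nhds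
  obtain ⟨s, hs, hs0, hsr⟩ := (h1.and (Ioo_mem_nhdsGT hr.1)).exists
  have hs' : s ∈ Ioc 0 R := ⟨hs0, hsr.le.trans hr.2⟩
  have h2 := S.monotoneOn_rpow_mul_energy D hs' hr hsr.le
  have h3 : energy g f α γ lam u r = 0 := by simp [energy, wflux, hv, hu]
  have h4 : 0 < energy g f α γ lam u s :=
    add_pos_of_nonneg_of_pos
      (mul_nonneg (Real.rpow_nonneg hs0.le _) (D.prim_g_nonneg _))
      (mul_pos D.lam_pos (D.prim_f_pos hs))
  simp only [h3, mul_zero] at h2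
  exact absurd h2 (not_le.2 (mul_pos (Real.rpow_pos_of_pos hs0 _) h4))

end energy

section uniqueness

theorem Data.g_sub_le (D : Data g f p α γ lam R M) {x y B η : ℝ} (hx : 0 < x)
    (hyx : y ≤ (1 + η) * x) (hxB : x ≤ B) (hη : 0 ≤ η) (hη1 : η ≤ 1) :
    g y - g x ≤ p * Real.exp p * g B * η := by
  have hp := D.p_pos
  have h1 : g y ≤ (1 + η) ^ p * g x :=
    (D.g_mono.monotone hyx).trans (D.g_scale _ (by linarith) _ hx)
  have h2 : (1 + η) ^ p ≤ 1 + p * Real.exp p * η := by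
    have e1 : (1 + η) ^ p ≤ Real.exp (η * p) := by
      rw [Real.exp_mul]
      exact Real.rpow_le_rpow (by linarith) (by linarith [Real.add_one_le_exp η]) hp.le
    have e2 : Real.exp (η * p) * (1 - η * p) ≤ 1 := by
      have := Real.add_one_le_exp (-(η * p))
      rw [Real.exp_neg] at this
      have h := mul_le_mul_of_nonneg_left this (Real.exp_pos (η * p)).le
      rw [mul_inv_cancel₀ (Real.exp_pos _).ne'] at h
      linarith
    have e3 : η * p * Real.exp (η * p) ≤ η * p * Real.exp p := by
      gcongr
      nlinarith
    nlinarith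
  have h3 : 0 < g x := D.g_pos hx
  have h4 : g x ≤ g B := D.g_mono.monotone hxB
  have h5 : (1 + η) ^ p * g x ≤ (1 + p * Real.exp p * η) * g x :=
    mul_le_mul_of_nonneg_right h2 h3.le
  have h6 : p * Real.exp p * η * g x ≤ p * Real.exp p * η * g B :=
    mul_le_mul_of_nonneg_left h4 (by positivity)
  linarith

theorem Data.abs_g_sub_le_of_pos (D : Data g f p α γ lam R M) {x y Y B η : ℝ} (hY : 0 < Y)
    (hx : |x - Y| ≤ Y / 2) (hy : |y - Y| ≤ Y / 2) (hxy : |x - y| ≤ η * (Y / 2))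
    (hxB : |x| ≤ B) (hyB : |y| ≤ B) (hη : 0 ≤ η) :
    |g x - g y| ≤ (p * Real.exp p + 2) * g B * η := by
  have hp := D.p_pos
  have h1 := abs_le.1 hx
  have h2 := abs_le.1 hy
  have h3 := abs_le.1 hxy
  have h4 := abs_le.1 hxB
  have h5 := abs_le.1 hyB
  have hB : 0 < g B := D.g_pos (by linarith)
  have hpe : 0 < p * Real.exp p := by positivity
  rcases le_total η 1 with hη1 | hη1
  · have h6 := D.g_sub_le (x := x) (y := y) (B := B) (by linarith) (by nlinarith) h4.2 hη hη1
    have h7 := D.g_sub_le (x := y) (y := x) (B := B) (by linarith) (by nlinarith) h5.2 hη hη1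
    have : 0 ≤ g B * η := by positivity
    rw [abs_le]
    constructor <;> linarith
  · have h6 := D.abs_g_le hxB
    have h7 := D.abs_g_le hyB
    have h8 := abs_sub (g x) (g y)
    have h9 : g B ≤ g B * η := le_mul_of_one_le_right hB.le hη1
    have : 0 ≤ p * Real.exp p * (g B * η) := by positivity
    linarith

theorem Data.abs_g_sub_le (D : Data g f p α γ lam R M) {x y Y B η : ℝ} (hY : Y ≠ 0)
    (hx : |x - Y| ≤ |Y| / 2) (hy : |y - Y| ≤ |Y| / 2) (hxy : |x - y| ≤ η * (|Y| / 2))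
    (hxB : |x| ≤ B) (hyB : |y| ≤ B) (hη : 0 ≤ η) :
    |g x - g y| ≤ (p * Real.exp p + 2) * g B * η := by
  rcases hY.lt_or_gt with h | h
  · rw [abs_of_neg h] at hx hy hxy
    have := D.abs_g_sub_le_of_pos (x := -x) (y := -y) (B := B) (neg_pos.2 h)
      (by rwa [show -x - -Y = -(x - Y) by ring, abs_neg])
      (by rwa [show -y - -Y = -(y - Y) by ring, abs_neg])
      (by rwa [show -x - -y = -(x - y) by ring, abs_neg])
      (by rwa [abs_neg]) (by rwa [abs_neg]) hη
    rwa [D.g_odd, D.g_odd, show -g x - -g y = -(g x - g y) by ring, abs_neg] at this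
  · rw [abs_of_pos h] at hx hy hxy
    exact D.abs_g_sub_le_of_pos h hx hy hxy hxB hyB hη

theorem Data.flux_sub (D : Data g f p α γ lam R M) (hu : Continuous u) (c s : ℝ) :
    flux f γ lam u s - flux f γ lam u c = -(lam * ∫ t in c..s, t ^ γ * f (u t)) := by
  have hi := fun a b => (D.continuous_integrand hu).intervalIntegrable (μ := volume) a b
  rw [flux, flux, ← intervalIntegral.integral_add_adjacent_intervals (hi 0 c) (hi c s)]
  ring

theorem Data.abs_prim_f_sub_le (D : Data g f p α γ lam R M) (x y : ℝ) :
    |prim f x - prim f y| ≤ M * |x - y| :=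
  convex_univ.norm_image_sub_le_of_norm_hasDerivWithin_le
    (fun r _ => (hasDerivAt_prim D.f_cont r).hasDerivWithinAt)
    (fun r _ => D.f_bdd r) (mem_univ y) (mem_univ x)

/-- The local estimate behind uniqueness: on `(c, b]` the slopes of two solutions differ by a
multiple of the maximal difference of the solutions. -/
def SlopeEstimate (g f : ℝ → ℝ) (α γ lam : ℝ) (u₁ u₂ : ℝ → ℝ) (c b C : ℝ) : Prop :=
  ∀ b' ∈ Ioc c b, ∀ ρ, 0 ≤ ρ → (∀ t ∈ Icc c b', |u₁ t - u₂ t| ≤ ρ) →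
    ∀ s ∈ Ioc c b', |g (wflux f α γ lam u₁ s) - g (wflux f α γ lam u₂ s)| ≤ C * ρ

theorem exists_right_nhd {P : ℝ → Prop} {c R : ℝ} (hc : c < R) (h : ∀ᶠ t in 𝓝 c, P t) :
    ∃ b ∈ Ioo c R, ∀ t ∈ Icc c b, P t := by
  obtain ⟨l, r, hlr, hP⟩ := mem_nhds_iff_exists_Ioo_subset.1 h
  obtain ⟨b, hb1, hb2⟩ := exists_between (lt_min hc hlr.2)
  exact ⟨b, ⟨hb1, hb2.trans_le (min_le_left _ _)⟩, fun t ht =>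
    hP ⟨hlr.1.trans_le ht.1, ht.2.trans_lt (hb2.trans_le (min_le_right _ _))⟩⟩

theorem Data.slopeEstimate_of_flux_eq_zero (D : Data g f p α γ lam R M) {u₁ u₂ : ℝ → ℝ}
    (hu₁ : Continuous u₁) (hu₂ : Continuous u₂) {c : ℝ} (hc0 : 0 ≤ c) (hcR : c < R)
    (heq : u₁ c = u₂ c) (hne : u₁ c ≠ 0) (hf₁ : flux f γ lam u₁ c = 0)
    (hf₂ : flux f γ lam u₂ c = 0) :
    ∃ b ∈ Ioo c R, ∃ C, 0 ≤ C ∧ SlopeEstimate g f α γ lam u₁ u₂ c b C := by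
  obtain ⟨L, hL, ε, hε, hlip⟩ := D.f_lip _ hne
  set x₀ := u₁ c with hx₀
  have hfx : f x₀ ≠ 0 := fun h => by simpa [h] using D.f_sign x₀ hne
  have hfx' : 0 < |f x₀| := abs_pos.2 hfx
  have hlam := D.lam_pos
  have hE : ∀ v : ℝ → ℝ, Continuous v → v c = x₀ →
      ∀ᶠ t in 𝓝 c, |v t - x₀| < ε ∧ |f (v t) - f x₀| ≤ |f x₀| / 2 := by
    intro v hv hvc
    refine Eventually.and ?_ ?_
    · have : Continuous fun t => |v t - x₀| := (hv.sub continuous_const).abs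
      exact this.continuousAt.eventually_lt continuousAt_const (by simpa [hvc] using hε)
    · have : Continuous fun t => |f (v t) - f x₀| := ((D.f_cont.comp hv).sub continuous_const).abs
      have h := this.continuousAt.eventually_lt (x₀ := c)
        (continuousAt_const (y := |f x₀| / 2)) (by simpa [hvc] using hfx)
      exact h.mono fun _ => le_of_lt
  obtain ⟨b, hb, hbP⟩ := exists_right_nhd hcR ((hE u₁ hu₁ rfl).and (hE u₂ hu₂ heq.symm))
  set B := lam * M * R ^ (γ + 1 - α) with hB
  have hgB : 0 < g B :=
    D.g_pos (mul_pos (mul_pos D.lam_pos D.M_pos) (Real.rpow_pos_of_pos D.R_pos _))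
  refine ⟨b, hb, (p * Real.exp p + 2) * g B * (2 * L / |f x₀|), ?_, ?_⟩
  · have := D.p_pos
    positivity
  intro b' hb' ρ hρ hdiff s hs
  have hsR : s ∈ Icc 0 R := ⟨hc0.trans hs.1.le, (hs.2.trans hb'.2).trans hb.2.le⟩
  have hs0 : 0 < s := hc0.trans_lt hs.1
  have hwpos : 0 < s ^ (-α) := Real.rpow_pos_of_pos hs0 _
  have hγ := Real.continuous_rpow_const D.gam_nonneg
  set J := ∫ t in c..s, t ^ γ with hJ
  have hJpos : 0 < J := by
    refine intervalIntegral.intervalIntegral_pos_of_pos_on (hγ.intervalIntegrable _ _)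
      (fun t ht => Real.rpow_pos_of_pos (hc0.trans_lt ht.1) _) hs.1
  -- a weighted integral of a bounded function is bounded by the bound times `J`
  have hint : ∀ (q : ℝ → ℝ) (K : ℝ), Continuous q → (∀ t ∈ Ioc c s, |q t| ≤ K) →
      |∫ t in c..s, t ^ γ * q t| ≤ K * J := by
    intro q K _ hK
    rw [hJ, ← intervalIntegral.integral_const_mul, ← Real.norm_eq_abs]
    refine intervalIntegral.norm_integral_le_of_norm_le hs.1.le
      (Eventually.of_forall fun t ht => ?_) ((hγ.intervalIntegrable _ _).const_mul K)
    rw [norm_mul, Real.norm_eq_abs, Real.norm_eq_abs,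
      abs_of_nonneg (Real.rpow_nonneg (hc0.trans ht.1.le) _), mul_comm]
    exact mul_le_mul_of_nonneg_right (hK t ht) (Real.rpow_nonneg (hc0.trans ht.1.le) _)
  have hi : ∀ v : ℝ → ℝ, Continuous v → IntervalIntegrable (fun t => t ^ γ * f (v t)) volume c s :=
    fun v hv => (D.continuous_integrand hv).intervalIntegrable _ _
  have hic : IntervalIntegrable (fun t => t ^ γ * f x₀) volume c s :=
    (hγ.mul continuous_const).intervalIntegrable _ _
  set Y := s ^ (-α) * -(lam * (J * f x₀)) with hY
  have hYabs : |Y| = s ^ (-α) * (lam * (J * |f x₀|)) := by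
    rw [hY, abs_mul, abs_neg, abs_mul, abs_mul, abs_of_pos hwpos, abs_of_pos hlam,
      abs_of_pos hJpos]
  have hYne : Y ≠ 0 := by
    rw [← abs_pos, hYabs]
    positivity
  have hclose : ∀ v : ℝ → ℝ, Continuous v → flux f γ lam v c = 0 →
      (∀ t ∈ Ioc c s, |f (v t) - f x₀| ≤ |f x₀| / 2) →
      |wflux f α γ lam v s - Y| ≤ |Y| / 2 := by
    intro v hv hvc hvt
    have h1 := D.flux_sub hv c s
    rw [hvc, sub_zero] at h1
    have h2 := hint (fun t => f (v t) - f x₀) _ ((D.f_cont.comp hv).sub continuous_const) hvt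
    simp only [mul_sub] at h2
    rw [intervalIntegral.integral_sub (hi v hv) hic, intervalIntegral.integral_mul_const,
      ← hJ] at h2
    rw [wflux, h1, hYabs, hY, ← mul_sub, abs_mul, abs_of_pos hwpos,
      show ∀ a b : ℝ, -(lam * a) - -(lam * b) = -(lam * (a - b)) by intros; ring, abs_neg,
      abs_mul, abs_of_pos hlam]
    calc _ ≤ s ^ (-α) * (lam * (|f x₀| / 2 * J)) := by gcongr
      _ = _ := by ring
  have hsub : ∀ t ∈ Ioc c s, t ∈ Icc c b := fun t ht =>
    ⟨ht.1.le, ht.2.trans (hs.2.trans hb'.2)⟩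
  have h12 : |wflux f α γ lam u₁ s - wflux f α γ lam u₂ s| ≤
      (2 * L / |f x₀| * ρ) * (|Y| / 2) := by
    have h1 := D.flux_sub hu₁ c s
    have h2 := D.flux_sub hu₂ c s
    rw [hf₁, sub_zero] at h1
    rw [hf₂, sub_zero] at h2
    have h3 := hint (fun t => f (u₁ t) - f (u₂ t)) (L * ρ)
      ((D.f_cont.comp hu₁).sub (D.f_cont.comp hu₂)) fun t ht => by
        have h := hbP t (hsub t ht)
        exact (hlip _ _ h.1.1 h.2.1).trans
          (mul_le_mul_of_nonneg_left (hdiff t ⟨ht.1.le, ht.2.trans hs.2⟩) hL)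
    simp only [mul_sub] at h3
    rw [intervalIntegral.integral_sub (hi u₁ hu₁) (hi u₂ hu₂)] at h3
    rw [wflux, wflux, h1, h2, ← mul_sub, abs_mul, abs_of_pos hwpos,
      show ∀ a b : ℝ, -(lam * a) - -(lam * b) = -(lam * (a - b)) by intros; ring, abs_neg,
      abs_mul, abs_of_pos hlam, hYabs]
    calc _ ≤ s ^ (-α) * (lam * (L * ρ * J)) := by gcongr
      _ = _ := by field_simp
  have := D.abs_g_sub_le hYne
    (hclose u₁ hu₁ hf₁ fun t ht => (hbP t (hsub t ht)).1.2)
    (hclose u₂ hu₂ hf₂ fun t ht => (hbP t (hsub t ht)).2.2) h12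
    (D.abs_wflux_le_of_mem u₁ hsR) (D.abs_wflux_le_of_mem u₂ hsR) (by positivity)
  rwa [← mul_assoc] at this

theorem IsSol.integral_abs_f_sub_le (D : Data g f p α γ lam R M) {u₁ u₂ : ℝ → ℝ}
    (S₁ : IsSol g f α γ lam R d u₁) (hu₂ : Continuous u₂)
    {c s κ ρ : ℝ} (hc : 0 < c) (hcs : c ≤ s) (hsR : s < R) (hκ : 0 < κ) (hρ : 0 ≤ ρ)
    (hdiff : ∀ t ∈ Icc c s, |u₁ t - u₂ t| ≤ ρ)
    (hslope : (∀ t ∈ Icc c s, κ ≤ g (wflux f α γ lam u₁ t)) ∨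
      ∀ t ∈ Icc c s, κ ≤ -g (wflux f α γ lam u₁ t)) :
    ∫ t in c..s, |f (u₁ t) - f (u₂ t)| ≤ 4 * M * ρ / κ := by
  set q : ℝ → ℝ := fun t => f (u₁ t + ρ) - f (u₁ t - ρ) with hq
  have hM := D.M_pos
  have hu₁ := S₁.cont
  have hqc : Continuous q := (D.f_cont.comp (hu₁.add continuous_const)).sub
    (D.f_cont.comp (hu₁.sub continuous_const))
  have hq0 : ∀ t, 0 ≤ q t := fun t => sub_nonneg.2 (D.f_mono (by linarith))
  have hsl := D.continuous_slope hu₁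
  have h1 : ∫ t in c..s, |f (u₁ t) - f (u₂ t)| ≤ ∫ t in c..s, q t := by
    refine intervalIntegral.integral_mono_on hcs
      (((D.f_cont.comp hu₁).sub (D.f_cont.comp hu₂)).abs.intervalIntegrable _ _)
      (hqc.intervalIntegrable _ _) fun t ht => ?_
    have h := abs_le.1 (hdiff t ht)
    have e1 := D.f_mono (show u₁ t ≤ u₁ t + ρ by linarith)
    have e2 := D.f_mono (show u₁ t - ρ ≤ u₁ t by linarith)
    have e3 := D.f_mono (show u₂ t ≤ u₁ t + ρ by linarith)
    have e4 := D.f_mono (show u₁ t - ρ ≤ u₂ t by linarith)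
    rw [hq, abs_le]
    constructor <;> linarith
  have h2 : ∫ t in c..s, q t * g (wflux f α γ lam u₁ t) =
      (prim f (u₁ s + ρ) - prim f (u₁ s - ρ)) - (prim f (u₁ c + ρ) - prim f (u₁ c - ρ)) := by
    refine intervalIntegral.integral_eq_sub_of_hasDerivAt
      (f := fun t => prim f (u₁ t + ρ) - prim f (u₁ t - ρ)) (fun t ht => ?_)
      ((hqc.mul hsl).intervalIntegrable _ _)
    rw [uIcc_of_le hcs] at ht
    have hd := S₁.hasDerivAt D ⟨hc.trans_le ht.1, ht.2.trans_lt hsR⟩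
    refine (((hasDerivAt_prim D.f_cont _).comp t (hd.add_const ρ)).sub
      ((hasDerivAt_prim D.f_cont _).comp t (hd.sub_const ρ))).congr_deriv ?_
    rw [hq]
    ring
  have h3 : |∫ t in c..s, q t * g (wflux f α γ lam u₁ t)| ≤ 4 * M * ρ := by
    have e1 := D.abs_prim_f_sub_le (u₁ s + ρ) (u₁ s - ρ)
    have e2 := D.abs_prim_f_sub_le (u₁ c + ρ) (u₁ c - ρ)
    rw [show ∀ a : ℝ, a + ρ - (a - ρ) = 2 * ρ by intros; ring,
      abs_of_nonneg (show (0:ℝ) ≤ 2 * ρ by linarith)] at e1 e2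
    rw [h2]
    refine (abs_sub _ _).trans ?_
    linarith
  have h4 : ∫ t in c..s, q t * κ ≤ |∫ t in c..s, q t * g (wflux f α γ lam u₁ t)| := by
    rcases hslope with h | h
    · refine le_trans ?_ (le_abs_self _)
      exact intervalIntegral.integral_mono_on hcs
        ((hqc.mul continuous_const).intervalIntegrable _ _)
        ((hqc.mul hsl).intervalIntegrable _ _)
        fun t ht => mul_le_mul_of_nonneg_left (h t ht) (hq0 t)
    · refine le_trans ?_ (neg_le_abs _)
      rw [← intervalIntegral.integral_neg]
      refine intervalIntegral.integral_mono_on hcs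
        ((hqc.mul continuous_const).intervalIntegrable _ _)
        ((hqc.mul hsl).neg.intervalIntegrable _ _)
        fun t ht => ?_
      rw [← mul_neg]
      exact mul_le_mul_of_nonneg_left (h t ht) (hq0 t)
  rw [intervalIntegral.integral_mul_const] at h4
  rw [le_div_iff₀ hκ]
  exact (mul_le_mul_of_nonneg_right h1 hκ.le).trans (h4.trans h3)

theorem IsSol.slopeEstimate_of_flux_ne_zero (D : Data g f p α γ lam R M) {u₁ u₂ : ℝ → ℝ}
    (S₁ : IsSol g f α γ lam R d u₁) (hu₂ : Continuous u₂) {c : ℝ} (hc0 : 0 < c) (hcR : c < R)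
    (hf : flux f γ lam u₁ c = flux f γ lam u₂ c) (hne : flux f γ lam u₁ c ≠ 0) :
    ∃ b ∈ Ioo c R, ∃ C, 0 ≤ C ∧ SlopeEstimate g f α γ lam u₁ u₂ c b C := by
  have hlam := D.lam_pos
  have hM := D.M_pos
  have hR := D.R_pos
  have hu₁ := S₁.cont
  set Y := wflux f α γ lam u₁ c with hY
  have hYne : Y ≠ 0 := mul_ne_zero (Real.rpow_pos_of_pos hc0 _).ne' hne
  have hYpos : 0 < |Y| := abs_pos.2 hYne
  have hE : ∀ v : ℝ → ℝ, Continuous v → wflux f α γ lam v c = Y →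
      ∀ᶠ t in 𝓝 c, |wflux f α γ lam v t - Y| ≤ |Y| / 2 := by
    intro v hv hvc
    have : Continuous fun t => |wflux f α γ lam v t - Y| :=
      ((D.continuous_wflux hv).sub continuous_const).abs
    have h := this.continuousAt.eventually_lt (x₀ := c)
      (continuousAt_const (y := |Y| / 2)) (by simpa [hvc] using hYne)
    exact h.mono fun _ => le_of_lt
  obtain ⟨b, hb, hbP⟩ := exists_right_nhd hcR
    ((hE u₁ hu₁ rfl).and (hE u₂ hu₂ (by rw [hY, wflux, wflux, hf])))
  obtain ⟨N, hN⟩ := isCompact_Icc.exists_bound_of_continuousOn (s := Icc c R)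
    (f := fun s : ℝ => s ^ (-α)) fun s hs =>
      (Real.continuousAt_rpow_const s _ (Or.inl (hc0.trans_le hs.1).ne')).continuousWithinAt
  have hN0 : 0 ≤ N := (norm_nonneg _).trans (hN c ⟨le_rfl, hcR.le⟩)
  set κ := g (|Y| / 2) with hκdef
  have hκ : 0 < κ := D.g_pos (by linarith)
  set B := lam * M * R ^ (γ + 1 - α) with hB
  have hgB : 0 < g B := D.g_pos (mul_pos (mul_pos hlam hM) (Real.rpow_pos_of_pos hR _))
  set K := N * (lam * (R ^ γ * (4 * M / κ))) with hK
  have hK0 : 0 ≤ K := by positivity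
  refine ⟨b, hb, (p * Real.exp p + 2) * g B * (K * (2 / |Y|)), ?_, ?_⟩
  · have := D.p_pos
    positivity
  intro b' hb' ρ hρ hdiff s hs
  have hsb : s ≤ b := hs.2.trans hb'.2
  have hsR' : s < R := hsb.trans_lt hb.2
  have hsR : s ∈ Icc 0 R := ⟨hc0.le.trans hs.1.le, hsR'.le⟩
  have hsub : ∀ t ∈ Icc c s, t ∈ Icc c b := fun t ht => ⟨ht.1, ht.2.trans hsb⟩
  have hI : ∫ t in c..s, |f (u₁ t) - f (u₂ t)| ≤ 4 * M * ρ / κ := by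
    refine S₁.integral_abs_f_sub_le D hu₂ hc0 hs.1.le hsR' hκ hρ
      (fun t ht => hdiff t ⟨ht.1, ht.2.trans hs.2⟩) ?_
    rcases hYne.lt_or_gt with h | h
    · refine Or.inr fun t ht => ?_
      have h1 := abs_le.1 (hbP t (hsub t ht)).1
      rw [abs_of_neg h] at h1
      rw [← D.g_odd, hκdef, abs_of_neg h]
      exact D.g_mono.monotone (by linarith)
    · refine Or.inl fun t ht => ?_
      have h1 := abs_le.1 (hbP t (hsub t ht)).1
      rw [abs_of_pos h] at h1
      rw [hκdef, abs_of_pos h]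
      exact D.g_mono.monotone (by linarith)
  have h12 : |wflux f α γ lam u₁ s - wflux f α γ lam u₂ s| ≤ (K * (2 / |Y|) * ρ) * (|Y| / 2) := by
    have h1 := D.flux_sub hu₁ c s
    have h2 := D.flux_sub hu₂ c s
    have hi : ∀ v : ℝ → ℝ, Continuous v →
        IntervalIntegrable (fun t => t ^ γ * f (v t)) volume c s :=
      fun v hv => (D.continuous_integrand hv).intervalIntegrable _ _
    have h3 : flux f γ lam u₁ s - flux f γ lam u₂ s =
        -(lam * ∫ t in c..s, (t ^ γ * f (u₁ t) - t ^ γ * f (u₂ t))) := by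
      rw [intervalIntegral.integral_sub (hi u₁ hu₁) (hi u₂ hu₂)]
      linarith
    have h4 : |∫ t in c..s, (t ^ γ * f (u₁ t) - t ^ γ * f (u₂ t))| ≤
        R ^ γ * (4 * M * ρ / κ) := by
      have h5 : |∫ t in c..s, (t ^ γ * f (u₁ t) - t ^ γ * f (u₂ t))| ≤
          ∫ t in c..s, R ^ γ * |f (u₁ t) - f (u₂ t)| := by
        rw [← Real.norm_eq_abs]
        refine intervalIntegral.norm_integral_le_of_norm_le hs.1.le
          (Eventually.of_forall fun t ht => ?_) ?_
        · have ht0 : 0 ≤ t := hc0.le.trans ht.1.le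
          rw [← mul_sub, norm_mul, Real.norm_eq_abs, Real.norm_eq_abs,
            abs_of_nonneg (Real.rpow_nonneg ht0 _)]
          exact mul_le_mul_of_nonneg_right
            (Real.rpow_le_rpow ht0 (ht.2.trans hsR'.le) D.gam_nonneg) (abs_nonneg _)
        · exact (((D.f_cont.comp hu₁).sub (D.f_cont.comp hu₂)).abs.const_mul
            _).intervalIntegrable _ _
      rw [intervalIntegral.integral_const_mul] at h5
      exact h5.trans (mul_le_mul_of_nonneg_left hI (Real.rpow_nonneg hR.le _))
    have hNs := hN s ⟨hs.1.le, hsR'.le⟩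
    rw [Real.norm_eq_abs] at hNs
    rw [wflux, wflux, ← mul_sub, h3, abs_mul, abs_neg, abs_mul, abs_of_pos hlam]
    calc _ ≤ N * (lam * (R ^ γ * (4 * M * ρ / κ))) := by gcongr
      _ = _ := by rw [hK]; field_simp
  have := D.abs_g_sub_le hYne (hbP s ⟨hs.1.le, hsb⟩).1 (hbP s ⟨hs.1.le, hsb⟩).2 h12
    (D.abs_wflux_le_of_mem u₁ hsR) (D.abs_wflux_le_of_mem u₂ hsR) (by positivity)
  rwa [← mul_assoc] at this

theorem IsSol.exists_eq_right (D : Data g f p α γ lam R M) {u₁ u₂ : ℝ → ℝ}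
    (S₁ : IsSol g f α γ lam R d u₁) (S₂ : IsSol g f α γ lam R d u₂) (hd : d ≠ 0)
    {c : ℝ} (hc : c ∈ Ico 0 R) (heq : ∀ t ∈ Icc 0 c, u₁ t = u₂ t) :
    ∃ b ∈ Ioo c R, ∀ t ∈ Icc 0 b, u₁ t = u₂ t := by
  have hf := flux_congr (f := f) (γ := γ) (lam := lam) hc.1 heq
  obtain ⟨b, hb, C, hC, hest⟩ :
      ∃ b ∈ Ioo c R, ∃ C, 0 ≤ C ∧ SlopeEstimate g f α γ lam u₁ u₂ c b C := by
    by_cases h : flux f γ lam u₁ c = 0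
    · refine D.slopeEstimate_of_flux_eq_zero S₁.cont S₂.cont hc.1 hc.2
        (heq c ⟨hc.1, le_rfl⟩) (fun h0 => ?_) h (hf ▸ h)
      rcases hc.1.eq_or_lt with rfl | hc0
      · exact hd (S₁.zero D.R_pos.le ▸ h0)
      · exact S₁.flux_ne_zero D hd ⟨hc0, hc.2.le⟩ h0 h
    · refine S₁.slopeEstimate_of_flux_ne_zero D S₂.cont (hc.1.lt_of_ne ?_) hc.2 hf h
      rintro rfl
      exact h flux_zero
  have hCpos : 0 < 2 * C + 1 := by linarith
  set b' := min b (c + 1 / (2 * C + 1)) with hb'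
  have hcb' : c < b' := lt_min hb.1 (by have := one_div_pos.2 hCpos; linarith)
  have hb'R : b' < R := (min_le_left _ _).trans_lt hb.2
  obtain ⟨m, hm, hmax⟩ := isCompact_Icc.exists_isMaxOn (nonempty_Icc.2 hcb'.le)
    (S₁.cont.sub S₂.cont).abs.continuousOn
  set ρ := |u₁ m - u₂ m| with hρ
  have hdiff : ∀ t ∈ Icc c b', |u₁ t - u₂ t| ≤ ρ := fun t ht => hmax ht
  have hρ0 : 0 ≤ ρ := abs_nonneg _
  have hslope := hest b' ⟨hcb', min_le_left _ _⟩ ρ hρ0 hdiff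
  have hcm : ∀ t ∈ Icc c b', t ∈ Icc 0 R := fun t ht =>
    ⟨hc.1.trans ht.1, ht.2.trans hb'R.le⟩
  have hbound : |(u₁ m - u₂ m) - (u₁ c - u₂ c)| ≤ C * ρ * |m - c| := by
    rw [S₁.eq m (hcm m hm), S₂.eq m (hcm m hm), S₁.eq c ⟨hc.1, hc.2.le⟩,
      S₂.eq c ⟨hc.1, hc.2.le⟩]
    refine (convex_Icc c b').norm_image_sub_le_of_norm_hasDerivWithin_le
      (f := fun r => picard g f α γ lam d u₁ r - picard g f α γ lam d u₂ r)
      (fun s _ => ((D.hasDerivAt_picard S₁.cont d s).sub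
        (D.hasDerivAt_picard S₂.cont d s)).hasDerivWithinAt) (fun s hs => ?_)
      ⟨le_rfl, hcb'.le⟩ hm
    rcases hs.1.eq_or_lt with rfl | hs1
    · rw [wflux_congr hc.1 heq, sub_self, norm_zero]
      positivity
    · exact hslope s ⟨hs1, hs.2⟩
  rw [heq c ⟨hc.1, le_rfl⟩, sub_self, sub_zero, abs_of_nonneg (sub_nonneg.2 hm.1)] at hbound
  have hm' : m - c ≤ 1 / (2 * C + 1) := by
    have := hm.2.trans (min_le_right _ _)
    linarith
  have hzero : ρ = 0 := by
    have h1 : C * ρ * (m - c) ≤ C * ρ * (1 / (2 * C + 1)) :=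
      mul_le_mul_of_nonneg_left hm' (by positivity)
    have h2 : ρ ≤ C * ρ * (1 / (2 * C + 1)) := hbound.trans h1
    rw [mul_one_div, le_div_iff₀ hCpos] at h2
    nlinarith
  refine ⟨b', ⟨hcb', hb'R⟩, fun t ht => ?_⟩
  rcases le_total t c with h | h
  · exact heq t ⟨ht.1, h⟩
  · have := hdiff t ⟨h, ht.2⟩
    rw [hzero] at this
    exact sub_eq_zero.1 (abs_nonpos_iff.1 this)

theorem IsSol.unique (D : Data g f p α γ lam R M) {u₁ u₂ : ℝ → ℝ}
    (S₁ : IsSol g f α γ lam R d u₁) (S₂ : IsSol g f α γ lam R d u₂) (hd : d ≠ 0) :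
    ∀ t ∈ Icc 0 R, u₁ t = u₂ t := by
  have hR := D.R_pos
  let s : Set ℝ := {r | ∀ t, 0 ≤ t → u₁ (min t r) = u₂ (min t r)}
  have hs : ∀ r, 0 ≤ r → (r ∈ s ↔ ∀ t ∈ Icc 0 r, u₁ t = u₂ t) := by
    refine fun r hr => ⟨fun h t ht => ?_, fun h t ht => h _ ⟨le_min ht hr, min_le_right _ _⟩⟩
    have := h t ht.1
    rwa [min_eq_left ht.2] at this
  have hcl : IsClosed s := by
    simp only [s, Set.ofPred_forall]
    refine isClosed_iInter fun t => isClosed_iInter fun _ => isClosed_eq ?_ ?_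
    · exact S₁.cont.comp (continuous_const.min continuous_id)
    · exact S₂.cont.comp (continuous_const.min continuous_id)
  have hsub : Icc 0 R ⊆ s := by
    refine (hcl.inter isClosed_Icc).Icc_subset_of_forall_exists_gt ?_ ?_
    · rw [hs 0 le_rfl]
      intro t ht
      obtain rfl : t = 0 := le_antisymm ht.2 ht.1
      rw [S₁.zero hR.le, S₂.zero hR.le]
    · rintro c ⟨hcs, hc⟩ y hy
      rw [hs c hc.1] at hcs
      obtain ⟨b, hb, h⟩ := S₁.exists_eq_right D S₂ hd hc hcs
      have hcy : c < min b y := lt_min hb.1 hy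
      refine ⟨min b y, ?_, hcy, min_le_right _ _⟩
      rw [hs _ (hc.1.trans hcy.le)]
      exact fun t ht => h t ⟨ht.1, ht.2.trans (min_le_left _ _)⟩
  exact (hs R hR.le).1 (hsub ⟨hR.le, le_rfl⟩)

end uniqueness

/-- `f ^ (-p)` has a primitive on some `(0, ν)` that tends to `0` at `0`. -/
def HasPrimitiveAtZero (f : ℝ → ℝ) (p : ℝ) : Prop :=
  ∃ (P : ℝ → ℝ) (ν : ℝ), 0 < ν ∧ (∀ x ∈ Ioo 0 ν, HasDerivAt P (f x ^ (-p)) x) ∧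
    Tendsto P (𝓝[>] 0) (𝓝 0)

/-- `(u, v)` solves the first order system on `(a, b)`. -/
structure IsArc (g f : ℝ → ℝ) (α γ lam a b : ℝ) (u v : ℝ → ℝ) : Prop where
  left : ∀ r ∈ Ioo a b, HasDerivAt u (g (r ^ (-α) * v r)) r
  right : ∀ r ∈ Ioo a b, HasDerivAt v (-(lam * (r ^ γ * f (u r)))) r

section oscillation

variable {a b : ℝ} {v : ℝ → ℝ}

theorem IsArc.mono (A : IsArc g f α γ lam a b u v) {a' b' : ℝ} (h : Ioo a' b' ⊆ Ioo a b) :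
    IsArc g f α γ lam a' b' u v :=
  ⟨fun r hr => A.left r (h hr), fun r hr => A.right r (h hr)⟩

theorem IsArc.continuousOn_left (A : IsArc g f α γ lam a b u v) : ContinuousOn u (Ioo a b) :=
  fun r hr => (A.left r hr).continuousAt.continuousWithinAt

theorem IsArc.continuousOn_right (A : IsArc g f α γ lam a b u v) : ContinuousOn v (Ioo a b) :=
  fun r hr => (A.right r hr).continuousAt.continuousWithinAt

theorem IsArc.neg (D : Data g f p α γ lam R M) (A : IsArc g f α γ lam a b u v) :
    IsArc g (fun x => -f (-x)) α γ lam a b (fun r => -u r) fun r => -v r := by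
  refine ⟨fun r hr => ?_, fun r hr => ?_⟩
  · simpa only [mul_neg, D.g_odd] using (A.left r hr).fun_neg
  · simpa only [mul_neg, neg_neg] using (A.right r hr).fun_neg

theorem IsSol.isArc (D : Data g f p α γ lam R M) (S : IsSol g f α γ lam R d u) :
    IsArc g f α γ lam 0 R u (flux f γ lam u) :=
  ⟨fun _ hr => S.hasDerivAt D hr, fun r _ => D.hasDerivAt_flux S.cont r⟩

/-- A nonvanishing continuous function on an open interval has constant sign. -/
theorem pos_or_neg_of_ne_zero {w : ℝ → ℝ} (hw : ContinuousOn w (Ioo a b))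
    (h0 : ∀ r ∈ Ioo a b, w r ≠ 0) : (∀ r ∈ Ioo a b, 0 < w r) ∨ ∀ r ∈ Ioo a b, w r < 0 := by
  by_contra! h
  obtain ⟨⟨x, hx, hx'⟩, y, hy, hy'⟩ := h
  obtain ⟨z, hz, hz'⟩ := isPreconnected_Ioo.intermediate_value hx hy hw ⟨hx', hy'⟩
  exact h0 z hz hz'

theorem IsArc.exists_slope_right (A : IsArc g f α γ lam a b u v) {x y : ℝ}
    (hx : x ∈ Ioo a b) (hy : y ∈ Ioo a b) (hxy : x < y) :
    ∃ t ∈ Ioo x y, v x - v y = lam * (t ^ γ * f (u t)) * (y - x) := by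
  have hs : Icc x y ⊆ Ioo a b := Icc_subset_Ioo hx.1 hy.2
  obtain ⟨t, ht, h⟩ := exists_hasDerivAt_eq_slope v _ hxy (A.continuousOn_right.mono hs)
    fun t ht => A.right t (hs (Ioo_subset_Icc_self ht))
  refine ⟨t, ht, ?_⟩
  rw [eq_div_iff (sub_pos.2 hxy).ne'] at h
  linarith

theorem IsArc.le_abs_right (D : Data g f p α γ lam R M) {h : ℝ} (hh : 0 < h) (ha : 0 ≤ a)
    (A : IsArc g f α γ lam a (a + 5 * h) u v) (hu : ∀ r ∈ Ioo a (a + 5 * h), 0 < u r)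
    (hv : ∀ r ∈ Ioo a (a + 5 * h), v r ≠ 0) {r : ℝ} (hr : r ∈ Icc (a + 2 * h) (a + 3 * h)) :
    lam * (h ^ γ * f (u r)) * h ≤ |v r| := by
  have hlam := D.lam_pos
  have hr' : r ∈ Ioo a (a + 5 * h) := ⟨by linarith [hr.1], by linarith [hr.2]⟩
  have hD : ∀ t ∈ interior (Ioo a (a + 5 * h)), HasDerivWithinAt u (g (t ^ (-α) * v t))
      (interior (Ioo a (a + 5 * h))) t := by
    rw [interior_Ioo]
    exact fun t ht => (A.left t ht).hasDerivWithinAt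
  have hpow : ∀ t ∈ Ioo a (a + 5 * h), 0 < t ^ (-α) := fun t ht =>
    Real.rpow_pos_of_pos (ha.trans_lt ht.1) _
  have key : ∀ t, h ≤ t → f (u r) ≤ f (u t) →
      lam * (h ^ γ * f (u r)) * h ≤ lam * (t ^ γ * f (u t)) * h := by
    intro t ht hf
    have h1 := (D.f_pos (hu r hr')).le
    have h2 := Real.rpow_le_rpow hh.le ht D.gam_nonneg
    gcongr
    exact Real.rpow_nonneg (hh.le.trans ht) _
  rcases pos_or_neg_of_ne_zero A.continuousOn_right hv with hv | hv
  · have hmono : MonotoneOn u (Ioo a (a + 5 * h)) :=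
      monotoneOn_of_hasDerivWithinAt_nonneg (convex_Ioo _ _) A.continuousOn_left hD fun t ht => by
        rw [interior_Ioo] at ht
        exact (D.g_pos (mul_pos (hpow t ht) (hv t ht))).le
    have hy : r + h ∈ Ioo a (a + 5 * h) := ⟨by linarith [hr.1], by linarith [hr.2]⟩
    obtain ⟨t, ht, e⟩ := A.exists_slope_right hr' hy (by linarith)
    have := key t (by linarith [hr.1, ht.1]) (D.f_mono (hmono hr'
      ⟨hr'.1.trans ht.1, ht.2.trans hy.2⟩ ht.1.le))
    rw [abs_of_pos (hv r hr')]
    rw [add_sub_cancel_left] at e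
    linarith [hv _ hy]
  · have hanti : AntitoneOn u (Ioo a (a + 5 * h)) :=
      antitoneOn_of_hasDerivWithinAt_nonpos (convex_Ioo _ _) A.continuousOn_left hD fun t ht => by
        rw [interior_Ioo] at ht
        have := D.g_mono (mul_neg_of_pos_of_neg (hpow t ht) (hv t ht))
        rw [D.g_zero] at this
        exact this.le
    have hy : r - h ∈ Ioo a (a + 5 * h) := ⟨by linarith [hr.1], by linarith [hr.2]⟩
    obtain ⟨t, ht, e⟩ := A.exists_slope_right hy hr' (by linarith)
    have := key t (by linarith [hr.1, ht.1]) (D.f_mono (hanti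
      ⟨hy.1.trans ht.1, ht.2.trans hr'.2⟩ hr' ht.2.le))
    rw [abs_of_neg (hv r hr')]
    rw [sub_sub_cancel] at e
    linarith [hv _ hy]

theorem Data.exists_rpow_le_g (D : Data g f p α γ lam R M) {c : ℝ} (hc : 0 < c) :
    ∃ c₁, 0 < c₁ ∧ ∀ x, 0 < x → c₁ * f x ^ p ≤ g (c * f x) := by
  have hM := D.M_pos
  refine ⟨g (c * M) / M ^ p, div_pos (D.g_pos (by positivity)) (by positivity), fun x hx => ?_⟩
  have hf := D.f_pos hx
  have h1 : f x ≤ M := (le_abs_self _).trans (D.f_bdd x)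
  have h2 := D.g_scale (M / f x) ((one_le_div hf).2 h1) (c * f x) (by positivity)
  rw [show M / f x * (c * f x) = c * M by field_simp, Real.div_rpow hM.le hf.le] at h2
  have h3 : 0 < f x ^ p := Real.rpow_pos_of_pos hf _
  have h4 : 0 < M ^ p := Real.rpow_pos_of_pos hM _
  rw [div_mul_eq_mul_div, div_le_iff₀ h4]
  rw [div_mul_eq_mul_div, le_div_iff₀ h3] at h2
  linarith

theorem Data.exists_bound_of_ne_zero (D : Data g f p α γ lam R M) (hP : HasPrimitiveAtZero f p)
    {h : ℝ} (hh : 0 < h) : ∃ η, 0 < η ∧ ∀ (a : ℝ) (u v : ℝ → ℝ), 0 ≤ a → a + 5 * h ≤ R →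
      IsArc g f α γ lam a (a + 5 * h) u v → (∀ r ∈ Ioo a (a + 5 * h), 0 < u r) →
      (∀ r ∈ Ioo a (a + 5 * h), v r ≠ 0) → ∃ r ∈ Ioo a (a + 5 * h), η ≤ u r := by
  obtain ⟨P, ν, hν, hP, hP0⟩ := hP
  have hlam := D.lam_pos
  have hR := D.R_pos
  set K := min (h ^ (-α)) (R ^ (-α)) with hK
  have hKpos : 0 < K := lt_min (Real.rpow_pos_of_pos hh _) (Real.rpow_pos_of_pos hR _)
  have hKle : ∀ r ∈ Icc h R, K ≤ r ^ (-α) := by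
    intro r hr
    rcases le_total 0 (-α) with hα | hα
    · exact (min_le_left _ _).trans (Real.rpow_le_rpow hh.le hr.1 hα)
    · exact (min_le_right _ _).trans
        (Real.rpow_le_rpow_of_nonpos (hh.trans_le hr.1) hr.2 hα)
  have hhγ : 0 < h ^ γ := Real.rpow_pos_of_pos hh _
  obtain ⟨c₁, hc₁, hg⟩ := D.exists_rpow_le_g (c := K * (lam * h ^ γ * h)) (by positivity)
  have hev : ∀ᶠ x in 𝓝[>] 0, |P x| < c₁ * h / 2 := by
    have := (hP0.abs).eventually_lt_const (u := c₁ * h / 2) (by rw [abs_zero]; positivity)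
    exact this
  obtain ⟨η, hη, hη'⟩ := mem_nhdsGT_iff_exists_Ioo_subset.1 hev
  refine ⟨min η ν, lt_min hη hν, fun a u v ha hab A hu hv => ?_⟩
  by_contra! hlt
  have hs : Icc (a + 2 * h) (a + 3 * h) ⊆ Ioo a (a + 5 * h) :=
    Icc_subset_Ioo (by linarith) (by linarith)
  have hder : ∀ r ∈ Icc (a + 2 * h) (a + 3 * h),
      HasDerivAt (P ∘ u) (f (u r) ^ (-p) * g (r ^ (-α) * v r)) r := fun r hr =>
    (hP _ ⟨hu r (hs hr), (hlt r (hs hr)).trans_le (min_le_right _ _)⟩).comp r (A.left r (hs hr))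
  obtain ⟨t, ht, e⟩ := exists_hasDerivAt_eq_slope (P ∘ u) _
    (show a + 2 * h < a + 3 * h by linarith)
    (fun r hr => (hder r hr).continuousAt.continuousWithinAt)
    fun r hr => hder r (Ioo_subset_Icc_self hr)
  have ht := Ioo_subset_Icc_self ht
  have h0 : 0 < f (u t) := D.f_pos (hu t (hs ht))
  have h1 : K * (lam * h ^ γ * h) * f (u t) ≤ |t ^ (-α) * v t| := by
    have := A.le_abs_right D hh ha hu hv ht
    have h2 := hKle t ⟨by linarith [ht.1], by linarith [ht.2]⟩
    rw [abs_mul, abs_of_pos (hKpos.trans_le h2)]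
    calc _ = K * (lam * (h ^ γ * f (u t)) * h) := by ring
      _ ≤ _ := by
        have := hKpos.le.trans h2
        gcongr
  have h2 : c₁ * f (u t) ^ p ≤ |g (t ^ (-α) * v t)| := by
    refine (hg _ (hu t (hs ht))).trans ((D.g_mono.monotone h1).trans ?_)
    rcases le_total 0 (t ^ (-α) * v t) with h3 | h3
    · rw [abs_of_nonneg h3]
      exact le_abs_self _
    · rw [abs_of_nonpos h3, D.g_odd]
      exact neg_le_abs _
  have h3 : c₁ ≤ |f (u t) ^ (-p) * g (t ^ (-α) * v t)| := by
    have hp := Real.rpow_pos_of_pos h0 p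
    rw [abs_mul, abs_of_pos (Real.rpow_pos_of_pos h0 _), Real.rpow_neg h0.le, inv_mul_eq_div,
      le_div_iff₀ hp]
    exact h2
  rw [e, abs_div, show a + 3 * h - (a + 2 * h) = h by ring, abs_of_pos hh, le_div_iff₀ hh] at h3
  have hb : ∀ r ∈ Icc (a + 2 * h) (a + 3 * h), |P (u r)| < c₁ * h / 2 := fun r hr =>
    hη' ⟨hu r (hs hr), (hlt r (hs hr)).trans_le (min_le_left _ _)⟩
  have h4 := hb (a + 3 * h) ⟨by linarith, le_rfl⟩
  have h5 := hb (a + 2 * h) ⟨le_rfl, by linarith⟩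
  have h6 := abs_sub (P (u (a + 3 * h))) (P (u (a + 2 * h)))
  simp only [Function.comp] at h3
  linarith

theorem Data.exists_bound_of_pos (D : Data g f p α γ lam R M) (hP : HasPrimitiveAtZero f p)
    {h : ℝ} (hh : 0 < h) : ∃ η, 0 < η ∧ ∀ (a : ℝ) (u v : ℝ → ℝ), 0 ≤ a → a + 10 * h ≤ R →
      IsArc g f α γ lam a (a + 10 * h) u v → (∀ r ∈ Ioo a (a + 10 * h), 0 < u r) →
      ∃ r ∈ Ioo a (a + 10 * h), η ≤ u r := by
  obtain ⟨η, hη, H⟩ := D.exists_bound_of_ne_zero hP hh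
  refine ⟨η, hη, fun a u v ha hab A hu => ?_⟩
  have hanti : StrictAntiOn v (Ioo a (a + 10 * h)) := by
    refine strictAntiOn_of_hasDerivWithinAt_neg (f' := fun r => -(lam * (r ^ γ * f (u r))))
      (convex_Ioo _ _) A.continuousOn_right (fun r hr => ?_) fun r hr => ?_
    · rw [interior_Ioo] at hr ⊢
      exact (A.right r hr).hasDerivWithinAt
    · rw [interior_Ioo] at hr
      exact neg_neg_of_pos (mul_pos D.lam_pos (mul_pos
        (Real.rpow_pos_of_pos (ha.trans_lt hr.1) _) (D.f_pos (hu r hr))))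
  by_cases hv : ∀ r ∈ Ioo a (a + 5 * h), v r ≠ 0
  · have hs : Ioo a (a + 5 * h) ⊆ Ioo a (a + 10 * h) := Ioo_subset_Ioo_right (by linarith)
    obtain ⟨r, hr, h1⟩ := H a u v ha (by linarith) (A.mono hs) (fun r hr => hu r (hs hr)) hv
    exact ⟨r, hs hr, h1⟩
  · push Not at hv
    obtain ⟨c, hc, hc'⟩ := hv
    have hs : Ioo (a + 5 * h) (a + 5 * h + 5 * h) ⊆ Ioo a (a + 10 * h) :=
      Ioo_subset_Ioo (by linarith) (by linarith)
    obtain ⟨r, hr, h1⟩ := H (a + 5 * h) u v (by linarith) (by linarith) (A.mono hs)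
      (fun r hr => hu r (hs hr)) fun r hr => by
        have := hanti ⟨hc.1, hc.2.trans (by linarith)⟩ (hs hr) (hc.2.trans hr.1)
        rw [hc'] at this
        exact this.ne
    exact ⟨r, hs hr, h1⟩

/-- Solutions of small amplitude vanish in every subinterval of a given length. -/
theorem Data.exists_bound_of_zero_free (D : Data g f p α γ lam R M)
    (hP : HasPrimitiveAtZero f p) (hP' : HasPrimitiveAtZero (fun x => -f (-x)) p)
    {h : ℝ} (hh : 0 < h) : ∃ η, 0 < η ∧ ∀ (a : ℝ) (u v : ℝ → ℝ), 0 ≤ a → a + 10 * h ≤ R →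
      IsArc g f α γ lam a (a + 10 * h) u v → (∀ r ∈ Ioo a (a + 10 * h), |u r| < η) →
      ∃ r ∈ Ioo a (a + 10 * h), u r = 0 := by
  obtain ⟨η₁, h₁, H₁⟩ := D.exists_bound_of_pos hP hh
  obtain ⟨η₂, h₂, H₂⟩ := D.symm.exists_bound_of_pos hP' hh
  refine ⟨min η₁ η₂, lt_min h₁ h₂, fun a u v ha hab A hu => ?_⟩
  by_contra! hne
  rcases pos_or_neg_of_ne_zero A.continuousOn_left hne with hs | hs
  · obtain ⟨r, hr, h1⟩ := H₁ a u v ha hab A hs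
    exact (((le_abs_self _).trans_lt (hu r hr)).trans_le (min_le_left _ _)).not_ge h1
  · obtain ⟨r, hr, h1⟩ := H₂ a _ _ ha hab (A.neg D) fun r hr => neg_pos.2 (hs r hr)
    exact (((neg_le_abs _).trans_lt (hu r hr)).trans_le (min_le_right _ _)).not_ge h1

theorem Data.exists_amplitude_lt (D : Data g f p α γ lam R M) {η : ℝ} (hη : 0 < η) :
    ∃ δ, 0 < δ ∧ ∀ d ∈ Ioo 0 δ, ∀ u, IsSol g f α γ lam R d u → ∀ r ∈ Icc 0 R, |u r| < η := by
  have h0 : Tendsto (prim f) (𝓝 0) (𝓝 0) := by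
    simpa using (continuous_prim D.f_cont).tendsto 0
  have hev := h0.eventually_lt_const
    (lt_min (D.prim_f_pos hη.ne') (D.prim_f_pos (neg_neg_of_pos hη).ne))
  obtain ⟨δ, hδ, h⟩ := mem_nhdsGT_iff_exists_Ioo_subset.1 (hev.filter_mono nhdsWithin_le_nhds)
  refine ⟨δ, hδ, fun d hd u S r hr => ?_⟩
  have h1 : prim f (u r) < min (prim f η) (prim f (-η)) := (S.prim_f_le D hr).trans_lt (h hd)
  by_contra! h2
  rcases le_abs'.1 h2 with h3 | h3
  · have h4 := D.prim_f_strictAntiOn.antitoneOn (mem_Iic.2 (by linarith))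
      (mem_Iic.2 (neg_neg_of_pos hη).le) h3
    exact (h1.trans_le (min_le_right _ _)).not_ge h4
  · have h4 := D.prim_f_strictMonoOn.monotoneOn (mem_Ici.2 hη.le) (mem_Ici.2 (by linarith)) h3
    exact (h1.trans_le (min_le_left _ _)).not_ge h4

theorem Data.exists_many_zeros (D : Data g f p α γ lam R M)
    (hP : HasPrimitiveAtZero f p) (hP' : HasPrimitiveAtZero (fun x => -f (-x)) p) (n : ℕ) :
    ∃ δ, 0 < δ ∧ ∀ d ∈ Ioo 0 δ, ∀ u, IsSol g f α γ lam R d u →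
      ∃ z : Fin n → ℝ, StrictMono z ∧ ∀ i, z i ∈ Ioo 0 R ∧ u (z i) = 0 := by
  have hR := D.R_pos
  set h := R / (10 * (n + 1)) with hh
  have hhpos : 0 < h := by positivity
  have hhR : 10 * h * (n + 1) = R := by
    rw [hh]
    field_simp
  obtain ⟨η, hη, H⟩ := D.exists_bound_of_zero_free hP hP' hhpos
  obtain ⟨δ, hδ, H'⟩ := D.exists_amplitude_lt hη
  refine ⟨δ, hδ, fun d hd u S => ?_⟩
  have hle : ∀ i : Fin n, 10 * h * i + 10 * h ≤ R := by
    intro i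
    have : (i : ℝ) + 1 ≤ n := by exact_mod_cast i.2
    nlinarith
  have hge : ∀ i : Fin n, 0 ≤ 10 * h * i := fun i => by positivity
  have hz : ∀ i : Fin n, ∃ r ∈ Ioo (10 * h * i) (10 * h * i + 10 * h), u r = 0 := fun i =>
    H _ u _ (hge i) (hle i) ((S.isArc D).mono (Ioo_subset_Ioo (hge i) (hle i)))
      fun r hr => H' d hd u S r ⟨(hge i).trans hr.1.le, hr.2.le.trans (hle i)⟩
  choose z hz hz' using hz
  refine ⟨z, fun i j hij => ?_, fun i => ⟨Ioo_subset_Ioo (hge i) (hle i) (hz i), hz' i⟩⟩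
  have : (i : ℝ) + 1 ≤ j := by exact_mod_cast hij
  have h1 := (hz i).2
  have h2 := (hz j).1
  nlinarith

end oscillation

/-- `u` has at least `n` zeros in `J`. -/
def HasZeros (u : ℝ → ℝ) (n : ℕ) (J : Set ℝ) : Prop :=
  ∃ z : Fin n → ℝ, StrictMono z ∧ ∀ i, z i ∈ J ∧ u (z i) = 0

section counting

theorem HasZeros.mono {n : ℕ} {J K : Set ℝ} (h : HasZeros u n J) (hJ : J ⊆ K) :
    HasZeros u n K :=
  let ⟨z, hz, hz'⟩ := h
  ⟨z, hz, fun i => ⟨hJ (hz' i).1, (hz' i).2⟩⟩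

theorem HasZeros.congr {v : ℝ → ℝ} {n : ℕ} {J : Set ℝ} (h : HasZeros u n J) (hJ : EqOn u v J) :
    HasZeros v n J :=
  let ⟨z, hz, hz'⟩ := h
  ⟨z, hz, fun i => ⟨(hz' i).1, (hJ (hz' i).1).symm.trans (hz' i).2⟩⟩

theorem HasZeros.init {n : ℕ} (h : HasZeros u (n + 1) (Ioc 0 R)) : HasZeros u n (Ioo 0 R) :=
  let ⟨z, hz, hz'⟩ := h
  ⟨z ∘ Fin.castSucc, hz.comp (Fin.strictMono_castSucc), fun i =>
    ⟨⟨(hz' _).1.1, (hz (Fin.castSucc_lt_last i)).trans_le (hz' _).1.2⟩, (hz' _).2⟩⟩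

theorem HasZeros.right_eq_zero {n : ℕ} (h : HasZeros u (n + 1) (Ioc 0 R))
    (h' : ¬HasZeros u (n + 1) (Ioo 0 R)) : u R = 0 := by
  obtain ⟨z, hz, hz'⟩ := h
  by_contra hne
  have hlast : z (Fin.last n) < R := (hz' _).1.2.lt_of_ne fun e => hne (e ▸ (hz' _).2)
  exact h' ⟨z, hz, fun i =>
    ⟨⟨(hz' i).1.1, (hz.monotone (Fin.le_last i)).trans_lt hlast⟩, (hz' i).2⟩⟩

theorem HasZeros.finite_and_ncard_eq {n : ℕ} {J : Set ℝ} (h : HasZeros u n J)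
    (h' : ¬HasZeros u (n + 1) J) :
    {r ∈ J | u r = 0}.Finite ∧ {r ∈ J | u r = 0}.ncard = n := by
  have hle : ∀ t : Finset ℝ, (t : Set ℝ) ⊆ {r ∈ J | u r = 0} → t.card ≠ n + 1 := fun t ht hc =>
    h' ⟨t.orderEmbOfFin hc, (t.orderEmbOfFin hc).strictMono,
      fun i => ht (t.orderEmbOfFin_mem hc i)⟩
  have hfin : {r ∈ J | u r = 0}.Finite := by
    by_contra hinf
    obtain ⟨t, ht, hc⟩ := Set.Infinite.exists_subset_card_eq hinf (n + 1)
    exact hle t ht hc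
  refine ⟨hfin, le_antisymm ?_ ?_⟩
  · by_contra! hlt
    rw [ncard_eq_toFinset_card _ hfin] at hlt
    obtain ⟨t, ht, hc⟩ := Finset.exists_subset_card_eq hlt
    refine hle t (fun x hx => ?_) hc
    simpa using ht hx
  · obtain ⟨z, hz, hz'⟩ := h
    have h1 := ncard_le_ncard (range_subset_iff.2 hz') hfin
    rwa [Set.ncard_range_of_injective hz.injective, Nat.card_fin] at h1

/-- Having at least `n` zeros in `(0, R]` passes to limits of solutions. -/
theorem Data.hasZeros_of_tendsto (D : Data g f p α γ lam R M) (hd : d ≠ 0) {n : ℕ}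
    {w : ℕ → ℝ → ℝ} {e : ℕ → ℝ} (hw : ∀ k, IsSol g f α γ lam R (e k) (w k))
    (S : IsSol g f α γ lam R d u) (hu : TendstoUniformlyOn w u atTop (Icc 0 R))
    (hz : ∀ k, HasZeros (w k) n (Ioc 0 R)) : HasZeros u n (Ioc 0 R) := by
  have hR := D.R_pos
  choose z hz hz' using hz
  have hpt : ∀ t ∈ Icc 0 R, Tendsto (fun k => w k t) atTop (𝓝 (u t)) := fun t ht =>
    hu.tendsto_at ht
  obtain ⟨c, hc, ns, hns, hlim⟩ := (isCompact_univ_pi fun _ : Fin n => isCompact_Icc).tendsto_subseq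
    (x := z) fun k i _ => Ioc_subset_Icc_self (hz' k i).1
  have hlim' := tendsto_pi_nhds.1 hlim
  have hc' : ∀ i, c i ∈ Icc 0 R := fun i => hc i (mem_univ _)
  have hc0 : ∀ i, u (c i) = 0 := by
    intro i
    have h1 : Tendsto (fun k => w (ns k) (z (ns k) i)) atTop (𝓝 (u (c i))) :=
      TendstoUniformlyOn.tendsto_comp (fun s hs => hns.tendsto_atTop.eventually (hu s hs))
        S.cont.continuousWithinAt
        (tendsto_nhdsWithin_iff.2 ⟨hlim' i, Eventually.of_forall fun k =>
          Ioc_subset_Icc_self (hz' _ i).1⟩)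
    simp only [(hz' _ i).2] at h1
    exact tendsto_nhds_unique h1 tendsto_const_nhds
  have hcpos : ∀ i, c i ∈ Ioc 0 R := fun i => ⟨(hc' i).1.lt_of_ne fun h => hd <| by
    have := hc0 i
    rwa [← h, S.zero hR.le] at this, (hc' i).2⟩
  refine ⟨c, fun i j hij => ?_, fun i => ⟨hcpos i, hc0 i⟩⟩
  have hle : c i ≤ c j := le_of_tendsto_of_tendsto' (hlim' i) (hlim' j) fun k => (hz _ hij).le
  refine hle.lt_of_ne fun heq => S.flux_ne_zero D hd (hcpos i) (hc0 i) ?_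
  have hrolle : ∀ k, ∃ t ∈ Ioo (z k i) (z k j), flux f γ lam (w k) t = 0 := by
    intro k
    have h0 := (hz' k i).1.1
    have h1 := (hz' k j).1.2
    obtain ⟨t, ht, h⟩ := exists_hasDerivAt_eq_zero (hz k hij) (hw k).cont.continuousOn
      ((hz' k i).2.trans (hz' k j).2.symm) fun t ht =>
        (hw k).hasDerivAt D ⟨h0.trans ht.1, ht.2.trans_le h1⟩
    exact ⟨t, ht, (D.wflux_eq_zero_iff (h0.trans ht.1)).1 h⟩
  choose t ht ht' using hrolle
  have htlim : Tendsto (fun k => t (ns k)) atTop (𝓝 (c i)) :=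
    tendsto_of_tendsto_of_tendsto_of_le_of_le (hlim' i) (heq ▸ hlim' j)
      (fun k => (ht _).1.le) fun k => (ht _).2.le
  have h1 : Tendsto (fun k => flux f γ lam (w (ns k)) (c i)) atTop (𝓝 (flux f γ lam u (c i))) :=
    (D.tendsto_flux (fun k => (hw k).cont) hpt (hc' i)).comp hns.tendsto_atTop
  refine tendsto_nhds_unique h1 (squeeze_zero_norm
    (a := fun k => lam * (R ^ γ * M) * |c i - t (ns k)|) (fun k => ?_) ?_)
  · have h2 := D.abs_flux_sub_le (hw (ns k)).cont (hc' i)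
      (show t (ns k) ∈ Icc 0 R from ⟨((hz' (ns k) i).1.1.trans (ht _).1).le,
        (ht _).2.le.trans (hz' (ns k) j).1.2⟩)
    rwa [ht', sub_zero] at h2
  · simpa using (((tendsto_const_nhds (x := c i)).sub htlim).abs.const_mul (lam * (R ^ γ * M)))

theorem eventually_mul_neg_of_hasDerivAt {w : ℝ → ℝ} {x c : ℝ} (hw : HasDerivAt w c x)
    (hc : c ≠ 0) (hx : w x = 0) : ∀ᶠ ε in 𝓝[>] (0 : ℝ), w (x - ε) * w (x + ε) < 0 := by
  have h1 : Tendsto (fun ε : ℝ => x - ε) (𝓝[>] 0) (𝓝 x) :=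
    ((continuous_const.sub continuous_id).tendsto' 0 x (sub_zero x)).mono_left nhdsWithin_le_nhds
  have h2 : Tendsto (fun ε : ℝ => x + ε) (𝓝[>] 0) (𝓝 x) :=
    ((continuous_const.add continuous_id).tendsto' 0 x (add_zero x)).mono_left nhdsWithin_le_nhds
  wlog h : 0 < c generalizing w c
  · have h3 := this hw.fun_neg (neg_ne_zero.2 hc) (by simp [hx])
      (neg_pos.2 (hc.lt_of_le (not_lt.1 h)))
    simpa using h3
  have hs := eventually_nhdsWithin_sign_eq_of_deriv_pos (by rw [hw.deriv]; exact h) hx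
  filter_upwards [h1.eventually hs, h2.eventually hs, self_mem_nhdsWithin] with ε e1 e2 hε
  have hε : 0 < ε := hε
  rw [sub_sub_cancel_left, sign_neg (a := -ε) (neg_neg_of_pos hε), sign_eq_neg_one_iff] at e1
  rw [add_sub_cancel_left, sign_pos (a := ε) hε, sign_eq_one_iff] at e2
  exact mul_neg_of_neg_of_pos e1 e2

/-- Having at least `n` zeros in `(0, R)` is stable under perturbation of the initial value. -/
theorem Data.eventually_hasZeros (D : Data g f p α γ lam R M) (hd : d ≠ 0) {n : ℕ}
    {w : ℕ → ℝ → ℝ} (S : IsSol g f α γ lam R d u) (hw : ∀ k, Continuous (w k))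
    (hu : ∀ t ∈ Icc 0 R, Tendsto (fun k => w k t) atTop (𝓝 (u t)))
    (hz : HasZeros u n (Ioo 0 R)) : ∀ᶠ k in atTop, HasZeros (w k) n (Ioo 0 R) := by
  obtain ⟨z, hz, hz'⟩ := hz
  have hsub : ∀ x : ℝ, Tendsto (fun ε : ℝ => x - ε) (𝓝[>] 0) (𝓝 x) := fun x =>
    ((continuous_const.sub continuous_id).tendsto' 0 x (sub_zero x)).mono_left nhdsWithin_le_nhds
  have hadd : ∀ x : ℝ, Tendsto (fun ε : ℝ => x + ε) (𝓝[>] 0) (𝓝 x) := fun x =>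
    ((continuous_const.add continuous_id).tendsto' 0 x (add_zero x)).mono_left nhdsWithin_le_nhds
  have h1 : ∀ᶠ ε in 𝓝[>] (0 : ℝ), ∀ i, u (z i - ε) * u (z i + ε) < 0 ∧ 0 < z i - ε ∧
      z i + ε < R := by
    refine eventually_all.2 fun i => ?_
    obtain ⟨hi, hi'⟩ := hz' i
    refine (eventually_mul_neg_of_hasDerivAt (S.hasDerivAt D hi) ?_ hi').and
      (((hsub _).eventually_const_lt hi.1).and ((hadd _).eventually_lt_const hi.2))
    rw [Ne, D.wflux_eq_zero_iff hi.1]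
    exact S.flux_ne_zero D hd ⟨hi.1, hi.2.le⟩ hi'
  have h2 : ∀ᶠ ε in 𝓝[>] (0 : ℝ), ∀ i j, i < j → z i + ε < z j - ε := by
    refine eventually_all.2 fun i => eventually_all.2 fun j => ?_
    by_cases hij : i < j
    · filter_upwards [(hadd (z i)).eventually_lt (hsub (z j)) (hz hij)] with ε h _
      exact h
    · exact Eventually.of_forall fun _ h => absurd h hij
  obtain ⟨ε, ⟨h1, h2⟩, hε⟩ := ((h1.and h2).and self_mem_nhdsWithin).exists
  have hε : 0 < ε := hε
  have h3 : ∀ᶠ k in atTop, ∀ i, w k (z i - ε) * w k (z i + ε) < 0 :=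
    eventually_all.2 fun i => ((hu _ ⟨(h1 i).2.1.le, by linarith [(h1 i).2.2]⟩).mul
      (hu _ ⟨by linarith [(h1 i).2.1], (h1 i).2.2.le⟩)).eventually_lt_const (h1 i).1
  filter_upwards [h3] with k hk
  have h4 : ∀ i, ∃ x ∈ Icc (z i - ε) (z i + ε), w k x = 0 := by
    intro i
    have hle : z i - ε ≤ z i + ε := by linarith
    rcases mul_neg_iff.1 (hk i) with h | h
    · exact intermediate_value_Icc' hle (hw k).continuousOn ⟨h.2.le, h.1.le⟩
    · exact intermediate_value_Icc hle (hw k).continuousOn ⟨h.1.le, h.2.le⟩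
  choose x hx hx' using h4
  exact ⟨x, fun i j hij => ((hx i).2.trans_lt (h2 i j hij)).trans_le (hx j).1,
    fun i => ⟨⟨(h1 i).2.1.trans_le (hx i).1, (hx i).2.trans_lt (h1 i).2.2⟩, hx' i⟩⟩

/-- Below an initial value whose solutions have at most `n` zeros in `(0, R]` there is another one
whose solution vanishes at `R` and has exactly `n` zeros in `(0, R)`. -/
theorem Data.exists_next (D : Data g f p α γ lam R M)
    (hP : HasPrimitiveAtZero f p) (hP' : HasPrimitiveAtZero (fun x => -f (-x)) p) {n : ℕ} {e : ℝ}
    (he : 0 < e) (hn : ∀ u, IsSol g f α γ lam R e u → ¬HasZeros u (n + 1) (Ioc 0 R)) :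
    ∃ d ∈ Ioo 0 e, (∀ u, IsSol g f α γ lam R d u → ¬HasZeros u (n + 2) (Ioc 0 R)) ∧
      ∃ u, IsSol g f α γ lam R d u ∧ u R = 0 ∧
        {r ∈ Ioo 0 R | u r = 0}.Finite ∧ {r ∈ Ioo 0 R | u r = 0}.ncard = n := by
  obtain ⟨δ, hδ, hmany⟩ := D.exists_many_zeros hP hP' (n + 1)
  set s : Set ℝ :=
    {d | d ∈ Ioo 0 e ∧ ∃ u, IsSol g f α γ lam R d u ∧ HasZeros u (n + 1) (Ioo 0 R)} with hs
  have hmin : min δ e / 2 ∈ s := by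
    have h0 : 0 < min δ e := lt_min hδ he
    have h1 := min_le_left δ e
    have h2 := min_le_right δ e
    obtain ⟨u, S⟩ := D.exists_isSol (min δ e / 2)
    exact ⟨⟨by linarith, by linarith⟩, u, S, hmany _ ⟨by linarith, by linarith⟩ u S⟩
  have hbdd : BddAbove s := ⟨e, fun d hd => hd.1.2.le⟩
  set d := sSup s with hdef
  have hd0 : 0 < d := hmin.1.1.trans_le (le_csSup hbdd hmin)
  have hde : d ≤ e := csSup_le ⟨_, hmin⟩ fun d hd => hd.1.2.le
  obtain ⟨u, S, hu⟩ : ∃ u, IsSol g f α γ lam R d u ∧ HasZeros u (n + 1) (Ioc 0 R) := by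
    obtain ⟨x, -, hx, hxs⟩ := exists_seq_tendsto_sSup ⟨_, hmin⟩ hbdd
    choose hx0 w hw hz using hxs
    obtain ⟨u, S, ns, hns, hlim⟩ := D.exists_subseq_isSol hx hw
    exact ⟨u, S, D.hasZeros_of_tendsto hd0.ne' (fun k => hw (ns k)) S hlim
      fun k => (hz _).mono Ioo_subset_Ioc_self⟩
  have hlt : d < e := hde.lt_of_ne fun h => by
    rw [h] at S
    exact hn u S hu
  have hnot : ¬HasZeros u (n + 1) (Ioo 0 R) := by
    intro hz
    have hx : Tendsto (fun k : ℕ => d + (e - d) / 2 * (1 / ((k : ℝ) + 1))) atTop (𝓝 d) := by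
      simpa using (tendsto_one_div_add_atTop_nhds_zero_nat.const_mul ((e - d) / 2)).const_add d
    choose w hw using fun k : ℕ => D.exists_isSol (d + (e - d) / 2 * (1 / ((k : ℝ) + 1)))
    obtain ⟨v, T, ns, hns, hlim⟩ := D.exists_subseq_isSol hx hw
    have hzv : HasZeros v (n + 1) (Ioo 0 R) :=
      hz.congr fun t ht => S.unique D T hd0.ne' t (Ioo_subset_Icc_self ht)
    obtain ⟨k, hk⟩ := (D.eventually_hasZeros hd0.ne' T (fun k => (hw (ns k)).cont)
      (fun t ht => hlim.tendsto_at ht) hzv).exists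
    have h1 : 0 < 1 / ((ns k : ℝ) + 1) := Nat.one_div_pos_of_nat
    have h2 : 1 / ((ns k : ℝ) + 1) ≤ 1 := by
      rw [div_le_one (by positivity)]
      linarith [(ns k).cast_nonneg (α := ℝ)]
    have h3 : 0 < (e - d) / 2 * (1 / ((ns k : ℝ) + 1)) := mul_pos (by linarith) h1
    have h4 : (e - d) / 2 * (1 / ((ns k : ℝ) + 1)) ≤ (e - d) / 2 :=
      mul_le_of_le_one_right (by linarith) h2
    have h5 := le_csSup hbdd (show _ ∈ s from ⟨⟨by linarith, by linarith⟩, _, hw (ns k), hk⟩)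
    linarith
  refine ⟨d, ⟨hd0, hlt⟩, fun v T hv => hnot (hv.init.congr fun t ht =>
    T.unique D S hd0.ne' t (Ioo_subset_Icc_self ht)), u, S, hu.right_eq_zero hnot, ?_⟩
  exact hu.init.finite_and_ncard_eq hnot

theorem Data.exists_solutions (D : Data g f p α γ lam R M)
    (hP : HasPrimitiveAtZero f p) (hP' : HasPrimitiveAtZero (fun x => -f (-x)) p) {e : ℝ}
    (he : g (lam * M * R ^ (γ + 1 - α)) * R < e) :
    ∃ (d : ℕ → ℝ) (U : ℕ → ℝ → ℝ), StrictAnti d ∧ d 0 < e ∧ ∀ n, 0 < d n ∧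
      IsSol g f α γ lam R (d n) (U n) ∧ U n R = 0 ∧
        {r ∈ Ioo 0 R | U n r = 0}.Finite ∧ {r ∈ Ioo 0 R | U n r = 0}.ncard = n := by
  have hR := D.R_pos
  have hg : 0 < g (lam * M * R ^ (γ + 1 - α)) :=
    D.g_pos (mul_pos (mul_pos D.lam_pos D.M_pos) (Real.rpow_pos_of_pos hR _))
  have he0 : 0 < e := (mul_pos hg hR).trans he
  have hstart : ∀ u, IsSol g f α γ lam R e u → ¬HasZeros u 1 (Ioc 0 R) := by
    rintro u S ⟨z, -, hz⟩
    obtain ⟨hr, hr'⟩ := hz 0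
    have h1 := D.abs_picard_sub_le S.cont e (Ioc_subset_Icc_self hr) ⟨le_rfl, hR.le⟩
    rw [← S.eq _ (Ioc_subset_Icc_self hr), hr', picard_zero, zero_sub, sub_zero, abs_neg,
      abs_of_pos he0, abs_of_pos hr.1] at h1
    have h2 := mul_le_mul_of_nonneg_left hr.2 hg.le
    linarith
  let X : ℕ → Type := fun n =>
    {x : ℝ // 0 < x ∧ ∀ u, IsSol g f α γ lam R x u → ¬HasZeros u (n + 1) (Ioc 0 R)}
  choose nx h1 h2 h3 using fun (n : ℕ) (x : X n) => D.exists_next hP hP' x.2.1 x.2.2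
  let x : ∀ n, X n := fun n =>
    Nat.rec (motive := X) ⟨e, he0, hstart⟩ (fun n y => ⟨nx n y, (h1 n y).1, h2 n y⟩) n
  choose U hU using fun n => h3 n (x n)
  refine ⟨fun n => nx n (x n), U, strictAnti_nat_of_succ_lt fun n => (h1 (n + 1) (x (n + 1))).2,
    (h1 0 (x 0)).2, fun n => ⟨(h1 n (x n)).1, hU n⟩⟩

end counting

section bridge

variable {φ : ℝ → ℝ} {γ₁ γ₂ dinf B : ℝ}

theorem _root_.PhiHyp.rpow_mul_le (hφ : PhiHyp φ γ₁ γ₂) {m y : ℝ} (hm : 1 ≤ m) (hy : 0 < y) :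
    m ^ (γ₁ - 1) * (y * φ y) ≤ m * y * φ (m * y) := by
  obtain ⟨hpos, hC, -, -, -, -, -, -, hb⟩ := hφ
  have hdiff : ∀ t, 0 < t → HasDerivAt (fun s => s * φ s) (deriv (fun s => s * φ s) t) t :=
    fun t ht => (differentiableAt_id.mul ((hC.contDiffAt (Ioi_mem_nhds ht)).differentiableAt
      one_ne_zero)).hasDerivAt
  have hder : ∀ t, 0 < t → HasDerivAt (fun s => s * φ s * s ^ (-(γ₁ - 1)))
      (deriv (fun s => s * φ s) t * t ^ (-(γ₁ - 1)) +
        t * φ t * (-(γ₁ - 1) * t ^ (-(γ₁ - 1) - 1))) t := fun t ht =>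
    (hdiff t ht).mul (Real.hasDerivAt_rpow_const (Or.inl ht.ne'))
  have hmono : MonotoneOn (fun s => s * φ s * s ^ (-(γ₁ - 1))) (Ioi 0) := by
    refine monotoneOn_of_hasDerivWithinAt_nonneg (convex_Ioi 0)
      (fun t ht => (hder t ht).continuousAt.continuousWithinAt)
      (fun t ht => (hder t (by simpa using ht)).hasDerivWithinAt) fun t ht => ?_
    have ht : 0 < t := by simpa using ht
    have h1 := (le_div_iff₀ (hpos t ht)).1 (hb t ht).1
    rw [Real.rpow_sub_one ht.ne']
    have h2 : 0 < t ^ (-(γ₁ - 1)) := Real.rpow_pos_of_pos ht _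
    have h3 : t * φ t * (-(γ₁ - 1) * (t ^ (-(γ₁ - 1)) / t)) =
        -((γ₁ - 1) * φ t * t ^ (-(γ₁ - 1))) := by
      field_simp
    rw [h3]
    have := mul_le_mul_of_nonneg_right h1 h2.le
    linarith
  have hm0 : 0 < m := one_pos.trans_le hm
  have h := hmono (mem_Ioi.2 hy) (mem_Ioi.2 (mul_pos hm0 hy)) (le_mul_of_one_le_left hy.le hm)
  simp only [Real.mul_rpow hm0.le hy.le] at h
  rw [Real.rpow_neg hm0.le, Real.rpow_neg hy.le] at h
  have h1 : 0 < y ^ (γ₁ - 1) := Real.rpow_pos_of_pos hy _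
  have h2 : 0 < m ^ (γ₁ - 1) := Real.rpow_pos_of_pos hm0 _
  rw [← mul_assoc, mul_le_mul_iff_left₀ (inv_pos.2 h1), ← div_eq_mul_inv, le_div_iff₀ h2] at h
  linarith

/-- The odd extension of `t ↦ t φ(t)` has a continuous inverse. -/
theorem _root_.PhiHyp.exists_inverse (hφ : PhiHyp φ γ₁ γ₂) :
    ∃ g : ℝ → ℝ, Continuous g ∧ StrictMono g ∧ (∀ x, g (-x) = -g x) ∧
      (∀ k, 1 ≤ k → ∀ x, 0 < x → g (k * x) ≤ k ^ (1 / (γ₁ - 1)) * g x) ∧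
      ∀ x, φ |g x| * g x = x := by
  have hscale := fun m y => hφ.rpow_mul_le (m := m) (y := y)
  obtain ⟨hpos, hC, -, h0, htop, hmono, hγ₁, -, -⟩ := hφ
  set ψ : ℝ → ℝ := fun x => φ |x| * x with hψ
  have hψpos : ∀ x, 0 < x → ψ x = x * φ x := fun x hx => by
    simp only [hψ, abs_of_pos hx, mul_comm]
  have hodd : ∀ x, ψ (-x) = -ψ x := fun x => by simp only [hψ, abs_neg, mul_neg]
  have hψ0 : ψ 0 = 0 := by simp [hψ]
  have hm : StrictMono ψ := by
    refine strictMono_of_odd_strictMonoOn_nonneg hodd fun x hx y hy hxy => ?_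
    rcases (mem_Ici.1 hx).eq_or_lt with rfl | hx
    · rw [hψ0, hψpos y hxy]
      exact mul_pos hxy (hpos y hxy)
    · rw [hψpos x hx, hψpos y (hx.trans hxy)]
      exact hmono hx (hx.trans hxy) hxy
  have hcont : Continuous ψ := by
    refine continuous_iff_continuousAt.2 fun x => ?_
    rcases eq_or_ne x 0 with rfl | hx
    · rw [continuousAt_iff_punctured_nhds, hψ0, tendsto_zero_iff_abs_tendsto_zero]
      have h1 : Tendsto (fun x : ℝ => |x|) (𝓝[≠] 0) (𝓝[>] 0) := tendsto_abs_nhdsNE_zero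
      refine (h0.comp h1).congr' ?_
      filter_upwards [self_mem_nhdsWithin] with x hx
      simp only [hψ, Function.comp]
      rw [abs_mul, abs_of_pos (hpos _ (abs_pos.2 hx)), mul_comm]
    · have h1 : ContinuousAt φ |x| := (hC.contDiffAt (Ioi_mem_nhds (abs_pos.2 hx))).continuousAt
      exact (h1.comp continuous_abs.continuousAt).mul continuousAt_id
  have hψtop : Tendsto ψ atTop atTop :=
    htop.congr' ((eventually_gt_atTop 0).mono fun x hx => (hψpos x hx).symm)
  have hψbot : Tendsto ψ atBot atBot := by
    have h1 := tendsto_neg_atTop_atBot.comp (hψtop.comp tendsto_neg_atBot_atTop)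
    refine h1.congr fun x => ?_
    simp only [Function.comp, hodd, neg_neg]
  let E := hm.orderIsoOfSurjective ψ (hcont.surjective hψtop hψbot)
  have hE : ∀ x, ψ (E.symm x) = x := fun x => E.apply_symm_apply x
  refine ⟨E.symm, E.symm.continuous, E.symm.strictMono, fun x => hm.injective ?_, ?_, hE⟩
  · rw [hE, hodd, hE]
  · intro k hk x hx
    have hk0 : 0 ≤ k := zero_le_one.trans hk
    have hy : 0 < E.symm x := by
      rw [← hm.lt_iff_lt, hE, hψ0]
      exact hx
    have hp : 0 < 1 / (γ₁ - 1) := one_div_pos.2 (sub_pos.2 hγ₁)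
    have hm1 : 1 ≤ k ^ (1 / (γ₁ - 1)) := Real.one_le_rpow hk hp.le
    rw [← hm.le_iff_le, hE, hψpos _ (mul_pos (one_pos.trans_le hm1) hy)]
    have h := hscale _ _ hm1 hy
    rwa [← Real.rpow_mul hk0, one_div_mul_cancel (sub_pos.2 hγ₁).ne', Real.rpow_one, ← hψpos _ hy,
      hE] at h

theorem hasPrimitiveAtZero_of_lintegral {ν : ℝ} (hν : 0 < ν) (hf : Continuous f)
    (hpos : ∀ x ∈ Ioo 0 ν, 0 < f x)
    (hfin : ∫⁻ t in Ioo 0 ν, ENNReal.ofReal (f t ^ (-p)) < ⊤) : HasPrimitiveAtZero f p := by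
  have hc : ContinuousOn (fun t => f t ^ (-p)) (Ioo 0 ν) := fun t ht =>
    (hf.continuousAt.rpow_const (Or.inl (hpos t ht).ne')).continuousWithinAt
  have hsm := hc.aestronglyMeasurable (μ := volume) measurableSet_Ioo
  have hint : IntegrableOn (fun t => f t ^ (-p)) (Ioo 0 ν) := by
    refine ⟨hsm, (hasFiniteIntegral_iff_ofReal ?_).2 hfin⟩
    exact (ae_restrict_mem measurableSet_Ioo).mono fun t ht => Real.rpow_nonneg (hpos t ht).le _
  have hii : IntervalIntegrable (fun t => f t ^ (-p)) volume 0 ν :=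
    (intervalIntegrable_iff_integrableOn_Ioo_of_le hν.le).2 hint
  refine ⟨fun x => ∫ t in (0 : ℝ)..x, f t ^ (-p), ν, hν, fun x hx => ?_, ?_⟩
  · refine intervalIntegral.integral_hasDerivAt_right (hii.mono_set ?_)
      (hc.stronglyMeasurableAtFilter isOpen_Ioo x hx) (hc.continuousAt (Ioo_mem_nhds hx.1 hx.2))
    rw [uIcc_of_le hx.1.le, uIcc_of_le hν.le]
    exact Icc_subset_Icc_right hx.2.le
  · have h1 : ContinuousOn (fun x => ∫ t in (0 : ℝ)..x, f t ^ (-p)) (Icc 0 ν) := by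
      rw [← uIcc_of_le hν.le]
      exact intervalIntegral.continuousOn_primitive_interval' hii left_mem_uIcc
    have h2 := (h1 0 ⟨le_rfl, hν.le⟩).tendsto
    rw [intervalIntegral.integral_same, nhdsWithin_Icc_eq_nhdsGE hν] at h2
    exact h2.mono_left (nhdsWithin_mono _ Ioi_subset_Ici_self)

/-- `f` frozen outside `[-B, dinf]`. -/
def truncate (f : ℝ → ℝ) (B dinf x : ℝ) : ℝ := f (max (-B) (min x dinf))

theorem truncate_of_mem {x : ℝ} (hx : x ∈ Icc (-B) dinf) : truncate f B dinf x = f x := by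
  rw [truncate, min_eq_left hx.2, max_eq_right hx.1]

theorem hasPrimitiveAtZero_truncate (hf : FHyp f dinf) (hf3 : F3Hyp f γ₁) (hB : 0 < B) :
    HasPrimitiveAtZero (truncate f B dinf) (1 / (γ₁ - 1)) := by
  obtain ⟨hc, -, hs, hdinf, -⟩ := hf
  obtain ⟨ν, hlt, hν0, hν⟩ := ((frequently_lt_of_liminf_lt (by isBoundedDefault) hf3.1).and_eventually
    (Ioo_mem_nhdsGT hdinf)).exists
  have heq : ∀ x ∈ Ioo 0 ν, truncate f B dinf x = f x := fun x hx =>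
    truncate_of_mem ⟨by linarith [hx.1], by linarith [hx.2]⟩
  refine hasPrimitiveAtZero_of_lintegral hν0 ?_ (fun x hx => ?_) ?_
  · exact hc.comp (continuous_const.max (continuous_id.min continuous_const))
  · rw [heq x hx]
    exact (pos_iff_pos_of_mul_pos (hs x hx.1.ne')).1 hx.1
  · refine (setLIntegral_congr_fun measurableSet_Ioo fun x hx => ?_).trans_lt hlt
    simp only [heq x hx, neg_div]

theorem hasPrimitiveAtZero_neg_truncate (hf : FHyp f dinf) (hf3 : F3Hyp f γ₁) (hB : 0 < B) :
    HasPrimitiveAtZero (fun x => -truncate f B dinf (-x)) (1 / (γ₁ - 1)) := by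
  obtain ⟨hc, -, hs, hdinf, -⟩ := hf
  obtain ⟨ν, hlt, hν, hν0⟩ := ((frequently_lt_of_liminf_lt (by isBoundedDefault) hf3.2).and_eventually
    (Ioo_mem_nhdsLT (neg_neg_of_pos hB))).exists
  have heq : ∀ x ∈ Ioo 0 (-ν), -truncate f B dinf (-x) = -f (-x) := fun x hx => by
    rw [truncate_of_mem ⟨by linarith [hx.2], by linarith [hx.1]⟩]
  refine hasPrimitiveAtZero_of_lintegral (neg_pos.2 hν0) ?_ (fun x hx => ?_) ?_
  · exact (hc.comp (continuous_const.max
      (continuous_neg.min continuous_const))).neg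
  · rw [heq x hx, neg_pos]
    exact (neg_iff_neg_of_mul_pos (hs (-x) (by linarith [hx.1]))).1 (by linarith [hx.1])
  · have h := (Measure.measurePreserving_neg (volume : Measure ℝ)).setLIntegral_comp_preimage_emb
      (Homeomorph.neg ℝ).measurableEmbedding
      (fun t => ENNReal.ofReal ((-f t) ^ (-1 / (γ₁ - 1)))) (Ioo ν 0)
    rw [← h, neg_preimage, neg_Ioo, neg_zero] at hlt
    refine (setLIntegral_congr_fun measurableSet_Ioo fun x hx => ?_).trans_lt hlt
    simp only [heq x hx, neg_div]

theorem _root_.FHyp.exists_le_prim (hf : FHyp f dinf) : ∃ B, 0 < B ∧ prim f dinf ≤ prim f (-B) := by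
  obtain ⟨hc, -, hs, hdinf, hm⟩ := hf
  have h1 : f (-1) < 0 := (neg_iff_neg_of_mul_pos (hs (-1) (by norm_num))).1 (by norm_num)
  have hdrop : ∀ a b, a < b → b ≤ 0 → -f b * (b - a) ≤ prim f a - prim f b := by
    intro a b hab hb
    obtain ⟨t, ht, h⟩ := exists_hasDerivAt_eq_slope (prim f) f hab
      (continuous_prim hc).continuousOn fun t _ => hasDerivAt_prim hc t
    rw [eq_div_iff (sub_pos.2 hab).ne'] at h
    have h2 := mul_le_mul_of_nonneg_right
      (hm (mem_Iic.2 (by linarith [ht.2])) (mem_Iic.2 (by linarith)) ht.2.le) (sub_pos.2 hab).le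
    linarith
  have h2 : 0 ≤ |prim f dinf| / -f (-1) := div_nonneg (abs_nonneg _) (by linarith)
  refine ⟨2 + |prim f dinf| / -f (-1), by linarith, ?_⟩
  have h3 := hdrop (-(2 + |prim f dinf| / -f (-1))) (-1) (by linarith) (by norm_num)
  have h4 := hdrop (-1) 0 (by norm_num) le_rfl
  have h5 : f 0 ≤ 0 := by
    by_contra! h
    obtain ⟨x, hx, hx0⟩ := ((hc.tendsto 0).eventually_const_lt h).filter_mono
      (nhdsWithin_le_nhds (s := Iio 0)) |>.and self_mem_nhdsWithin |>.exists
    have := hs x (ne_of_lt hx0)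
    exact (mul_neg_of_neg_of_pos hx0 hx).not_gt this
  rw [prim_zero] at h4
  have h6 : -f (-1) * (-1 - -(2 + |prim f dinf| / -f (-1))) = -f (-1) + |prim f dinf| := by
    rw [show ∀ X : ℝ, -1 - -(2 + X) = 1 + X by intro X; ring, mul_add, mul_one,
      mul_div_cancel₀ _ (neg_ne_zero.2 h1.ne)]
  have := le_abs_self (prim f dinf)
  linarith

theorem data_truncate (hφ : PhiHyp φ γ₁ γ₂) (hf : FHyp f dinf) (hαγ : max α (-α / (γ₁ - 1)) ≤ γ)
    (hR : 0 < R) (hB : 0 < B) (hlam : 0 < lam) (hg : Continuous g) (hgm : StrictMono g)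
    (hgo : ∀ x, g (-x) = -g x)
    (hgs : ∀ k, 1 ≤ k → ∀ x, 0 < x → g (k * x) ≤ k ^ (1 / (γ₁ - 1)) * g x) :
    Data g (truncate f B dinf) (1 / (γ₁ - 1)) α γ lam R (f dinf - f (-B)) := by
  obtain ⟨hc, hC, hs, hdinf, hm⟩ := hf
  have hγ₁ : 0 < γ₁ - 1 := sub_pos.2 hφ.2.2.2.2.2.2.1
  have hfpos : 0 < f dinf := (pos_iff_pos_of_mul_pos (hs dinf hdinf.ne')).1 hdinf
  have hfneg : f (-B) < 0 :=
    (neg_iff_neg_of_mul_pos (hs (-B) (neg_neg_of_pos hB).ne)).1 (neg_neg_of_pos hB)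
  have hle : ∀ x, max (-B) (min x dinf) ≤ dinf := fun x => max_le (by linarith) (min_le_right _ _)
  refine ⟨hg, hgm, hgo, one_div_pos.2 hγ₁, hgs,
    hc.comp (continuous_const.max (continuous_id.min continuous_const)), fun x y hxy => ?_,
    fun t ht => ?_, fun t => ?_, fun t ht => ?_, hlam, hR, (le_max_left _ _).trans hαγ, ?_⟩
  · exact hm (hle x) (hle y) (max_le_max le_rfl (min_le_min hxy le_rfl))
  · rcases ht.lt_or_gt with h | h
    · have h1 : max (-B) (min t dinf) < 0 := max_lt (by linarith) ((min_le_left _ _).trans_lt h)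
      exact mul_pos_of_neg_of_neg h ((neg_iff_neg_of_mul_pos (hs _ h1.ne)).1 h1)
    · have h1 : 0 < max (-B) (min t dinf) := lt_max_of_lt_right (lt_min h hdinf)
      exact mul_pos h ((pos_iff_pos_of_mul_pos (hs _ h1.ne')).1 h1)
  · have h1 : truncate f B dinf t ≤ f dinf := hm (hle t) (mem_Iic.2 le_rfl) (hle t)
    have h2 : f (-B) ≤ truncate f B dinf t :=
      hm (mem_Iic.2 (by linarith)) (hle t) (le_max_left _ _)
    rw [abs_le]
    constructor <;> linarith
  · have h1 : max (-B) (min t dinf) ≠ 0 := by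
      rcases ht.lt_or_gt with h | h
      · exact (max_lt (by linarith) ((min_le_left _ _).trans_lt h)).ne
      · exact (lt_max_of_lt_right (lt_min h hdinf)).ne'
    obtain ⟨K, s, hs, hK⟩ := (hC.contDiffAt
      (isOpen_compl_singleton.mem_nhds h1)).exists_lipschitzOnWith
    obtain ⟨ε, hε, hεs⟩ := Metric.mem_nhds_iff.1 hs
    have hclamp : ∀ x y : ℝ, |max (-B) (min x dinf) - max (-B) (min y dinf)| ≤ |x - y| :=
      fun x y => by
        refine (abs_max_sub_max_le_max _ _ _ _).trans ?_
        rw [sub_self, abs_zero]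
        refine max_le (abs_nonneg _) ((abs_min_sub_min_le_max _ _ _ _).trans ?_)
        rw [sub_self, abs_zero]
        exact max_le le_rfl (abs_nonneg _)
    refine ⟨K, K.2, ε, hε, fun x y hx hy => ?_⟩
    have h2 := hK.dist_le_mul _ (hεs (Metric.mem_ball.2 ((hclamp x t).trans_lt hx)))
      _ (hεs (Metric.mem_ball.2 ((hclamp y t).trans_lt hy)))
    exact h2.trans (mul_le_mul_of_nonneg_left (hclamp x y) K.2)
  · refine le_trans (le_of_eq ?_) ((le_max_right _ _).trans hαγ)
    ring

theorem IsSol.mem_Icc_of_truncate (D : Data g (truncate f B dinf) p α γ lam R M)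
    (hB : 0 < B) (hprim : prim f dinf ≤ prim f (-B)) (hd : d ∈ Ioc 0 dinf)
    (S : IsSol g (truncate f B dinf) α γ lam R d u) {r : ℝ} (hr : r ∈ Icc 0 R) :
    u r ∈ Icc (-B) dinf := by
  have hdinf : 0 < dinf := hd.1.trans_le hd.2
  have heq : ∀ x ∈ Icc (-B) dinf, prim (truncate f B dinf) x = prim f x := fun x hx =>
    intervalIntegral.integral_congr fun t ht => truncate_of_mem <|
      uIcc_subset_Icc ⟨by linarith, hdinf.le⟩ hx ht
  have h1 := (S.prim_f_le D hr).trans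
    (D.prim_f_strictMonoOn.monotoneOn (mem_Ici.2 hd.1.le) (mem_Ici.2 hdinf.le) hd.2)
  constructor
  · by_contra! h
    have h2 := D.prim_f_strictAntiOn (mem_Iic.2 (by linarith)) (mem_Iic.2 (by linarith)) h
    rw [heq dinf ⟨by linarith, le_rfl⟩] at h1
    rw [heq (-B) ⟨le_rfl, by linarith⟩] at h2
    linarith
  · by_contra! h
    have h2 := D.prim_f_strictMonoOn (mem_Ici.2 hdinf.le) (mem_Ici.2 (by linarith)) h
    linarith

theorem IsSol.isBVPSol {h : ℝ → ℝ} (D : Data g h p α γ lam R M)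
    (S : IsSol g h α γ lam R d u) (hg : ∀ x, φ |g x| * g x = x)
    (hh : ∀ r ∈ Icc 0 R, h (u r) = f (u r)) (hu : u R = 0) :
    IsBVPSol φ f α γ lam R u fun r => g (wflux h α γ lam u r) := by
  refine ⟨by simp only [wflux_zero, D.g_zero], hu, fun r hr => S.hasDerivWithinAt D hr,
    (D.continuous_slope S.cont).continuousOn, fun r hr => ?_⟩
  have heq : ∀ s ∈ Ioo 0 R, s ^ α * (φ |g (wflux h α γ lam u s)| * g (wflux h α γ lam u s)) =
      flux h γ lam u s := by
    intro s hs
    rw [hg, wflux, ← mul_assoc, ← Real.rpow_add hs.1, add_neg_cancel, Real.rpow_zero, one_mul]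
  refine ((D.hasDerivAt_flux S.cont r).hasDerivWithinAt.congr heq (heq r hr)).congr_deriv ?_
  rw [hh r (Ioo_subset_Icc_self hr), mul_assoc]

theorem pos_of_forall_ne_zero (hc : ContinuousOn u (Ico 0 R)) (h0 : 0 < u 0)
    (hne : ∀ r ∈ Ioo 0 R, u r ≠ 0) : ∀ r ∈ Ico 0 R, 0 < u r := by
  intro r hr
  by_contra! h
  obtain ⟨t, ht, ht0⟩ := intermediate_value_Icc' hr.1
    (hc.mono (Icc_subset_Ico_right hr.2)) ⟨h, h0.le⟩
  rcases ht.1.eq_or_lt with rfl | ht1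
  · exact h0.ne' ht0
  · exact hne t ⟨ht1, ht.2.trans_lt hr.2⟩ ht0

end bridge

end Shooting

/-- There exists `Λ > 0` such that for every `λ ∈ (0, Λ]` the boundary value
problem `(P_λ)` admits a positive solution `u₀` and an infinite sequence of solutions `u_ℓ`
(`ℓ ≥ 1`, here indexed by `n : ℕ` with `ℓ = n + 1`), together with a strictly decreasing
sequence `d∞ > d₁ > d₂ > ⋯ > 0`, such that `u_ℓ(0) = d_ℓ` and `u_ℓ` has precisely `ℓ`
zeroes in `(0, R)`. -/
theorem statement0 (φ f : ℝ → ℝ) (γ₁ γ₂ α γ dinf R : ℝ)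
    (hφ : PhiHyp φ γ₁ γ₂) (hf : FHyp f dinf) (hf3 : F3Hyp f γ₁)
    (hαγ : max α (-α / (γ₁ - 1)) ≤ γ) (hR : 0 < R) :
    ∃ Λ : ℝ, 0 < Λ ∧ ∀ lam : ℝ, 0 < lam → lam ≤ Λ →
      (∃ u₀ u₀' : ℝ → ℝ, IsBVPSol φ f α γ lam R u₀ u₀' ∧
        ∀ r ∈ Set.Ico (0:ℝ) R, 0 < u₀ r) ∧
      ∃ (U U' : ℕ → ℝ → ℝ) (d : ℕ → ℝ),
        StrictAnti d ∧ d 0 < dinf ∧ (∀ n, 0 < d n) ∧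
        ∀ n : ℕ, IsBVPSol φ f α γ lam R (U n) (U' n) ∧
          U n 0 = d n ∧
          ({r ∈ Set.Ioo (0:ℝ) R | U n r = 0}).Finite ∧
          ({r ∈ Set.Ioo (0:ℝ) R | U n r = 0}).ncard = n + 1 := by
  obtain ⟨g, hg, hgm, hgo, hgs, hginv⟩ := hφ.exists_inverse
  obtain ⟨B, hB, hprim⟩ := hf.exists_le_prim
  have hdinf : 0 < dinf := hf.2.2.2.1
  have hD := fun lam hlam => Shooting.data_truncate (lam := lam) hφ hf hαγ hR hB hlam hg hgm hgo hgs
  have hsmall : ∀ᶠ lam in 𝓝[>] (0 : ℝ),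
      g (lam * (f dinf - f (-B)) * R ^ (γ + 1 - α)) * R < dinf := by
    have hc : Continuous fun lam => g (lam * (f dinf - f (-B)) * R ^ (γ + 1 - α)) * R :=
      (hg.comp ((continuous_id.mul continuous_const).mul continuous_const)).mul continuous_const
    refine Filter.Tendsto.eventually_lt_const (v := 0) hdinf
      ((hc.tendsto' 0 0 ?_).mono_left nhdsWithin_le_nhds)
    simp only [zero_mul, (hD 1 one_pos).g_zero]
  obtain ⟨Λ, hΛ, hΛ'⟩ := mem_nhdsGT_iff_exists_Ioc_subset.1 hsmall
  refine ⟨Λ, hΛ, fun lam hlam hle => ?_⟩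
  have D := hD lam hlam
  obtain ⟨d, U, hd, hd0, hU⟩ := D.exists_solutions (Shooting.hasPrimitiveAtZero_truncate hf hf3 hB)
    (Shooting.hasPrimitiveAtZero_neg_truncate hf hf3 hB) (hΛ' ⟨hlam, hle⟩)
  have hsol : ∀ n, IsBVPSol φ f α γ lam R (U n)
      fun r => g (Shooting.wflux (Shooting.truncate f B dinf) α γ lam (U n) r) := by
    intro n
    obtain ⟨h0, S, h1, -⟩ := hU n
    exact S.isBVPSol D hginv (fun r hr => Shooting.truncate_of_mem (S.mem_Icc_of_truncate D hB hprim
      ⟨h0, (hd.antitone n.zero_le).trans hd0.le⟩ hr)) h1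
  have hzero : ∀ n, U n 0 = d n := fun n => (hU n).2.1.zero hR.le
  refine ⟨⟨U 0, _, hsol 0, ?_⟩, fun n => U (n + 1), _, fun n => d (n + 1),
    fun m n hmn => hd (Nat.succ_lt_succ hmn), (hd one_pos).trans hd0, fun n => (hU _).1,
    fun n => ⟨hsol (n + 1), hzero _, (hU (n + 1)).2.2.2⟩⟩
  refine Shooting.pos_of_forall_ne_zero (hU 0).2.1.cont.continuousOn (hzero 0 ▸ (hU 0).1)
    fun r hr h => ?_
  have hmem : r ∈ {r ∈ Ioo 0 R | U 0 r = 0} := ⟨hr, h⟩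
  rw [(ncard_eq_zero (hU 0).2.2.2.1).1 (hU 0).2.2.2.2] at hmem
  exact hmem

end
end

section
/- Let N ≥ 1 and for η ∈ ℝ^N ∖ {0} define a_j(η) = φ(|η|) η_j, 1 ≤ j ≤ N. Then there is a positive constant Γ₁, which may be taken as Γ₁ = min{1, γ₁ − 1}, such that for all η ∈ ℝ^N ∖ {0} and all ξ ∈ ℝ^N, ∑_{i,j=1}^N (∂a_j/∂η_i)(η) ξ_i ξ_j ≥ Γ₁ φ(|η|) |ξ|². -/
open Set Filter Topology MeasureTheory

noncomputable section

open scoped RealInnerProductSpace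

/-- Away from the origin, the norm of a real inner product space is differentiable, with
derivative `⟪‖x‖⁻¹ • x, ·⟫`. -/
theorem hasFDerivAt_norm_of_ne_zero {E : Type*} [NormedAddCommGroup E] [InnerProductSpace ℝ E]
    {x : E} (hx : x ≠ 0) :
    HasFDerivAt (fun y : E => ‖y‖) (‖x‖⁻¹ • innerSL ℝ x) x := by
  have h := (hasStrictFDerivAt_norm_sq x).hasFDerivAt.sqrt (pow_ne_zero 2 (norm_ne_zero_iff.2 hx))
  simp only [Real.sqrt_sq (norm_nonneg _)] at h
  convert h using 1
  ext v
  have := norm_ne_zero_iff.2 hx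
  simp
  field_simp

/-- The quadratic form of the derivative of the radial field `x ↦ f ‖x‖ • x`. -/
theorem inner_fderiv_radial_apply {E : Type*} [NormedAddCommGroup E] [InnerProductSpace ℝ E]
    {f : ℝ → ℝ} {x : E} (hx : x ≠ 0) (hf : DifferentiableAt ℝ f ‖x‖) (v : E) :
    ⟪fderiv ℝ (fun y : E => f ‖y‖ • y) x v, v⟫ =
      f ‖x‖ * ‖v‖ ^ 2 + deriv f ‖x‖ * ‖x‖⁻¹ * ⟪x, v⟫ ^ 2 := by
  have h := (hf.hasDerivAt.comp_hasFDerivAt x (hasFDerivAt_norm_of_ne_zero hx)).fun_smul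
    (hasFDerivAt_id x)
  have h' : HasFDerivAt (fun y : E => f ‖y‖ • y) _ x := h
  rw [h'.fderiv]
  simp [inner_add_left, real_inner_smul_left]
  ring

/-- For `N ≥ 1` and `a(η) = φ(|η|) η` on `ℝ^N \ {0}`, there is a positive
constant `Γ₁`, which may be taken as `Γ₁ = min{1, γ₁ - 1}`, such that for all `η ≠ 0` and
all `ξ`, `∑_{i,j} (∂a_j/∂η_i)(η) ξ_i ξ_j ≥ Γ₁ φ(|η|) |ξ|²`. -/
theorem statement16 (φ : ℝ → ℝ) (γ₁ γ₂ : ℝ)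
    (hφpos : ∀ t > (0:ℝ), 0 < φ t)
    (hφdiff : ∀ t > (0:ℝ), DifferentiableAt ℝ φ t)
    (hγ₁ : 1 < γ₁) (hγ₂ : 1 < γ₂)
    (hφ3 : ∀ t > (0:ℝ), (γ₁ - 2) * φ t ≤ t * deriv φ t ∧ t * deriv φ t ≤ (γ₂ - 2) * φ t)
    (N : ℕ) (hN : 1 ≤ N) :
    ∃ Γ₁ : ℝ, Γ₁ = min 1 (γ₁ - 1) ∧ 0 < Γ₁ ∧
      ∀ η ξ : EuclideanSpace ℝ (Fin N), η ≠ 0 →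
        Γ₁ * φ ‖η‖ * ‖ξ‖ ^ 2 ≤
          ⟪(fderiv ℝ (fun ζ : EuclideanSpace ℝ (Fin N) => φ ‖ζ‖ • ζ) η) ξ, ξ⟫ := by
  have hmin : 0 < min 1 (γ₁ - 1) := lt_min one_pos (by linarith)
  refine ⟨_, rfl, hmin, fun η ξ hη => ?_⟩
  have ht : 0 < ‖η‖ := norm_pos_iff.2 hη
  rw [inner_fderiv_radial_apply hη (hφdiff _ ht)]
  obtain ⟨s, hs⟩ : ∃ s, s = (⟪η, ξ⟫ / ‖η‖) ^ 2 := ⟨_, rfl⟩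
  have hs0 : 0 ≤ s := hs ▸ sq_nonneg _
  have hsξ : s ≤ ‖ξ‖ ^ 2 := by
    rw [hs, sq_le_sq, abs_div, abs_norm, abs_norm, div_le_iff₀ ht, mul_comm]
    exact abs_real_inner_le_norm η ξ
  have hform : deriv φ ‖η‖ * ‖η‖⁻¹ * ⟪η, ξ⟫ ^ 2 = ‖η‖ * deriv φ ‖η‖ * s := by
    rw [hs]
    field_simp
  rw [hform]
  have h₁ : min 1 (γ₁ - 1) * (‖ξ‖ ^ 2 - s) ≤ 1 * (‖ξ‖ ^ 2 - s) :=
    mul_le_mul_of_nonneg_right (min_le_left _ _) (sub_nonneg.2 hsξ)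
  have h₂ : min 1 (γ₁ - 1) * s ≤ (γ₁ - 1) * s :=
    mul_le_mul_of_nonneg_right (min_le_right _ _) hs0
  calc min 1 (γ₁ - 1) * φ ‖η‖ * ‖ξ‖ ^ 2
      = φ ‖η‖ * (min 1 (γ₁ - 1) * ‖ξ‖ ^ 2) := by ring
    _ ≤ φ ‖η‖ * (‖ξ‖ ^ 2 + (γ₁ - 2) * s) :=
      mul_le_mul_of_nonneg_left (by linarith) (hφpos _ ht).le
    _ = φ ‖η‖ * ‖ξ‖ ^ 2 + (γ₁ - 2) * φ ‖η‖ * s := by ring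
    _ ≤ φ ‖η‖ * ‖ξ‖ ^ 2 + ‖η‖ * deriv φ ‖η‖ * s :=
      add_le_add_right (mul_le_mul_of_nonneg_right (hφ3 _ ht).1 hs0) _

end
end

section
/- Let N ≥ 1. There is a constant Γ₁ > 0 (the ellipticity constant of Lemma on a_j(η) = φ(|η|)η_j) such that for all η, η′ ∈ ℝ^N, ⟨φ(|η|)η − φ(|η′|)η′, η − η′⟩ ≥ min{4, 4Γ₁} · (|η − η′| / (1 + |η| + |η′|)) · Φ(|η − η′| / 4), where φ(|ζ|)ζ is interpreted as 0 when ζ = 0. -/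
open Set Filter Topology MeasureTheory

noncomputable section

open scoped RealInnerProductSpace

/-- Along a unit direction `e`, the field `ζ ↦ φ ‖ζ‖ • ζ` restricts to `s ↦ (s * φ s) • e`. -/
lemma fderiv_norm_smul_self_radial {E : Type*} [NormedAddCommGroup E] [InnerProductSpace ℝ E]
    {φ : ℝ → ℝ} {e : E} (he : ‖e‖ = 1) {t : ℝ} (ht : 0 < t) (hd : DifferentiableAt ℝ φ t) :
    fderiv ℝ (fun ζ : E => φ ‖ζ‖ • ζ) (t • e) e = deriv (fun s => s * φ s) t • e := by
  have hnorm : ‖t • e‖ = t := by rw [norm_smul, he, mul_one, Real.norm_of_nonneg ht.le]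
  have hne : t • e ≠ 0 := norm_pos_iff.mp (hnorm.symm ▸ ht)
  have hdiff : DifferentiableAt ℝ (fun ζ : E => φ ‖ζ‖ • ζ) (t • e) := by
    have hd' : DifferentiableAt ℝ φ ‖t • e‖ := by rwa [hnorm]
    have hn : DifferentiableAt ℝ (fun ζ : E => ‖ζ‖) (t • e) := differentiableAt_id.norm ℝ hne
    exact (hd'.comp (t • e) hn).smul differentiableAt_id
  have hline : HasDerivAt (fun s : ℝ => s • e) e t := by
    simpa using (hasDerivAt_id t).smul_const e
  have hcomp := hdiff.hasFDerivAt.comp_hasDerivAt t hline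
  have hradial : HasDerivAt (fun s : ℝ => (s * φ s) • e) (deriv (fun s => s * φ s) t • e) t :=
    ((differentiableAt_id.mul hd).hasDerivAt).smul_const e
  refine hcomp.unique (hradial.congr_of_eventuallyEq ?_)
  filter_upwards [lt_mem_nhds ht] with s hs
  simp only [Function.comp_apply, norm_smul, he, mul_one, Real.norm_of_nonneg hs.le, smul_smul,
    mul_comm]

/-- If `(tφ(t))' ≥ m φ(t)` with `0 ≤ m ≤ 1`, the increment of `tφ(t)` over `[y, x]` is at least
`m (x - y) φ(x)`. -/
lemma mul_sub_mul_ge_of_deriv_ge {φ : ℝ → ℝ} {m : ℝ} (hm0 : 0 ≤ m) (hm1 : m ≤ 1)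
    (hpos : ∀ t > (0 : ℝ), 0 < φ t) (hd : ∀ t > (0 : ℝ), DifferentiableAt ℝ φ t)
    (hderiv : ∀ t > (0 : ℝ), m * φ t ≤ deriv (fun s => s * φ s) t)
    {x y : ℝ} (hx : 0 < x) (hy : 0 ≤ y) (hyx : y ≤ x) :
    m * (x - y) * φ x ≤ x * φ x - y * φ y := by
  rcases hy.eq_or_lt with rfl | hy
  · have := mul_le_mul_of_nonneg_right hm1 (mul_pos hx (hpos x hx)).le
    linarith
  have hderivAt : ∀ t > (0 : ℝ), HasDerivAt (fun s => s * φ s * s ^ (-m))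
      (deriv (fun s => s * φ s) t * t ^ (-m) + t * φ t * (-m * t ^ (-m - 1))) t := fun t ht =>
    (differentiableAt_id.mul (hd t ht)).hasDerivAt.mul
      (Real.hasDerivAt_rpow_const (Or.inl ht.ne'))
  have hmono : MonotoneOn (fun s => s * φ s * s ^ (-m)) (Ioi 0) := by
    refine monotoneOn_of_deriv_nonneg (convex_Ioi 0)
      (fun t ht => (hderivAt t ht).continuousAt.continuousWithinAt) ?_ ?_
    · rw [interior_Ioi]
      exact fun t ht => (hderivAt t ht).differentiableAt.differentiableWithinAt
    · rw [interior_Ioi]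
      intro t ht
      have ht' : 0 < t := ht
      have hpow : t ^ (-m) = t * t ^ (-m - 1) := by
        rw [Real.rpow_sub_one ht'.ne', mul_div_cancel₀ _ ht'.ne']
      rw [(hderivAt t ht).deriv, hpow]
      have h0 : 0 ≤ t * t ^ (-m - 1) := by positivity
      linarith [mul_le_mul_of_nonneg_right (hderiv t ht) h0]
  have hgrowth : y * φ y * y ^ (-m) ≤ x * φ x * x ^ (-m) := hmono hy hx hyx
  have hratio : y * φ y ≤ x * φ x * (y / x) ^ m := by
    have hym : 0 < y ^ m := by positivity
    rw [Real.rpow_neg hy.le, Real.rpow_neg hx.le, ← div_eq_mul_inv, ← div_eq_mul_inv,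
      div_le_iff₀ hym] at hgrowth
    rw [Real.div_rpow hy.le hx.le]
    calc y * φ y ≤ _ := hgrowth
      _ = _ := by ring
  have hbern : (y / x) ^ m ≤ 1 + m * (y / x - 1) := by
    have h := rpow_one_add_le_one_add_mul_self (s := y / x - 1)
      (by linarith [div_nonneg hy.le hx.le]) hm0 hm1
    simpa using h
  have hfx : 0 ≤ x * φ x := (mul_pos hx (hpos x hx)).le
  calc m * (x - y) * φ x = x * φ x - x * φ x * (1 + m * (y / x - 1)) := by field_simp; ring
    _ ≤ x * φ x - y * φ y := by linarith [mul_le_mul_of_nonneg_left hbern hfx]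

/-- Here `a`, `b` play the roles of `φ x`, `φ y`, and `d` is the third side of a triangle with
sides `x`, `y`. -/
lemma div_le_of_triangle_of_growth {x y d a b m c : ℝ} (hx : 0 < x) (hy : 0 ≤ y) (hyx : y ≤ x)
    (hd1 : x - y ≤ d) (hd2 : d ≤ x + y) (hm0 : 0 ≤ m) (hm1 : m ≤ 1) (ha : 0 ≤ a)
    (hb : 0 ≤ y * b) (hgrowth : m * (x - y) * a ≤ x * a - y * b) (hc : 0 ≤ c) (hca : c ≤ x * a) :
    m * d ^ 2 * c / (x + y) ≤ (a + b) / 2 * d ^ 2 + (a - b) / 2 * (x ^ 2 - y ^ 2) := by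
  have hS : 0 < x + y := by linarith
  have hd0 : 0 ≤ d := by linarith
  rw [div_le_iff₀ hS]
  rcases le_or_gt b a with hab | hab
  · have hd : d ^ 2 ≤ (x + y) ^ 2 := pow_le_pow_left₀ hd0 hd2 2
    have h1 : 0 ≤ (a - b) * (x - y) * ((x + y) ^ 2 - d ^ 2) :=
      mul_nonneg (mul_nonneg (by linarith) (by linarith)) (by linarith)
    have h2 : m * c ≤ x * a + y * b := by
      linarith [mul_le_mul_of_nonneg_right hm1 hc]
    have h3 := mul_le_mul_of_nonneg_left h2 (sq_nonneg d)
    linarith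
  · have hyx' : 0 < x - y := by
      rcases hyx.eq_or_lt with rfl | h
      · nlinarith
      · linarith
    have hd : (x - y) ^ 2 ≤ d ^ 2 := pow_le_pow_left₀ hyx'.le hd1 2
    have h1 : 0 ≤ (b - a) * (x + y) * (d ^ 2 - (x - y) ^ 2) :=
      mul_nonneg (mul_nonneg (by linarith) (by linarith)) (by linarith)
    have h2 := mul_le_mul_of_nonneg_left hgrowth (sq_nonneg d)
    have h3 : m * d ^ 2 * a ≤ (a + b) / 2 * d ^ 2 + (a - b) / 2 * (x ^ 2 - y ^ 2) := by
      refine le_of_mul_le_mul_right ?_ hyx'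
      linarith
    have h4 : c ≤ a * (x + y) := by linarith [mul_nonneg ha hy]
    calc m * d ^ 2 * c ≤ m * d ^ 2 * (a * (x + y)) := by gcongr
      _ = m * d ^ 2 * a * (x + y) := by ring
      _ ≤ _ := mul_le_mul_of_nonneg_right h3 hS.le

lemma inner_smul_sub_smul_sub {E : Type*} [NormedAddCommGroup E] [InnerProductSpace ℝ E]
    (a b : ℝ) (u v : E) :
    inner ℝ (a • u - b • v) (u - v) =
      (a + b) / 2 * ‖u - v‖ ^ 2 + (a - b) / 2 * (‖u‖ ^ 2 - ‖v‖ ^ 2) := by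
  rw [norm_sub_sq_real]
  simp only [inner_sub_left, inner_sub_right, real_inner_smul_left, real_inner_self_eq_norm_sq,
    real_inner_comm u v]
  ring

lemma PhiFun_le_mul {φ : ℝ → ℝ} (hpos : ∀ t > (0 : ℝ), 0 < φ t)
    (hmono : MonotoneOn (fun t => t * φ t) (Ioi 0)) {t : ℝ} (ht : 0 < t) :
    PhiFun φ t ≤ t * φ t * t := by
  have h := intervalIntegral.norm_integral_le_of_norm_le_const (a := 0) (b := t)
    (f := fun s => s * φ s) (C := t * φ t) fun s hs => by
      rw [uIoc_of_le ht.le] at hs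
      rw [Real.norm_of_nonneg (mul_pos hs.1 (hpos s hs.1)).le]
      exact hmono hs.1 ht hs.2
  rw [sub_zero, abs_of_pos ht] at h
  exact (Real.le_norm_self _).trans h

/-- The monotonicity estimate under the one-dimensional ellipticity condition
`(tφ(t))' ≥ m φ(t)`. -/
lemma inner_ge_of_deriv_ge {E : Type*} [NormedAddCommGroup E] [InnerProductSpace ℝ E]
    {φ : ℝ → ℝ} {m : ℝ} (hm0 : 0 ≤ m) (hm1 : m ≤ 1)
    (hpos : ∀ t > (0 : ℝ), 0 < φ t) (hd : ∀ t > (0 : ℝ), DifferentiableAt ℝ φ t)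
    (hmono : MonotoneOn (fun t => t * φ t) (Ioi 0))
    (hderiv : ∀ t > (0 : ℝ), m * φ t ≤ deriv (fun s => s * φ s) t)
    {u v : E} (hvu : ‖v‖ ≤ ‖u‖) :
    4 * m * (‖u - v‖ / (1 + ‖u‖ + ‖v‖)) * PhiFun φ (‖u - v‖ / 4) ≤
      inner ℝ (φ ‖u‖ • u - φ ‖v‖ • v) (u - v) := by
  rcases (norm_nonneg (u - v)).eq_or_lt with h0 | hpos_d
  · have huv : u - v = 0 := norm_eq_zero.mp h0.symm
    simp [huv]
  have htri : ‖u - v‖ ≤ ‖u‖ + ‖v‖ := norm_sub_le u v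
  have hu : 0 < ‖u‖ := by linarith
  have hv : 0 ≤ ‖v‖ * φ ‖v‖ := by
    rcases (norm_nonneg v).eq_or_lt with h | h
    · simp [← h]
    · exact (mul_pos h (hpos _ h)).le
  have hd4 : 0 < ‖u - v‖ / 4 := by positivity
  have hc : 0 < ‖u - v‖ / 4 * φ (‖u - v‖ / 4) := mul_pos hd4 (hpos _ hd4)
  have hcu : ‖u - v‖ / 4 * φ (‖u - v‖ / 4) ≤ ‖u‖ * φ ‖u‖ := hmono hd4 hu (by linarith)
  rw [inner_smul_sub_smul_sub]
  refine le_trans ?_ (div_le_of_triangle_of_growth hu (norm_nonneg v) hvu (norm_sub_norm_le u v)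
    htri hm0 hm1 (hpos _ hu).le hv
    (mul_sub_mul_ge_of_deriv_ge hm0 hm1 hpos hd hderiv hu (norm_nonneg v) hvu) hc.le hcu)
  calc 4 * m * (‖u - v‖ / (1 + ‖u‖ + ‖v‖)) * PhiFun φ (‖u - v‖ / 4)
      ≤ 4 * m * (‖u - v‖ / (1 + ‖u‖ + ‖v‖)) *
          (‖u - v‖ / 4 * φ (‖u - v‖ / 4) * (‖u - v‖ / 4)) := by
        gcongr
        exact PhiFun_le_mul hpos hmono hd4
    _ = m * ‖u - v‖ ^ 2 * (‖u - v‖ / 4 * φ (‖u - v‖ / 4)) / (1 + ‖u‖ + ‖v‖) := by ring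
    _ ≤ m * ‖u - v‖ ^ 2 * (‖u - v‖ / 4 * φ (‖u - v‖ / 4)) / (‖u‖ + ‖v‖) := by
        refine div_le_div_of_nonneg_left (by positivity) (by positivity) (by linarith)

/-- Simon type inequality. With `Γ₁ > 0` the ellipticity constant for
`a(η) = φ(|η|) η`, for all `η, η' ∈ ℝ^N`,
`⟨φ(|η|)η - φ(|η'|)η', η - η'⟩ ≥ min{4, 4Γ₁} · (|η-η'|/(1+|η|+|η'|)) · Φ(|η-η'|/4)`
(with `φ(|ζ|)ζ` interpreted as `0` when `ζ = 0`). -/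
theorem statement17 (φ : ℝ → ℝ) (γ₁ γ₂ : ℝ) (hφ : PhiHyp φ γ₁ γ₂)
    (N : ℕ) (hN : 1 ≤ N) (Γ₁ : ℝ) (hΓ₁ : 0 < Γ₁)
    (hell : ∀ η ξ : EuclideanSpace ℝ (Fin N), η ≠ 0 →
      Γ₁ * φ ‖η‖ * ‖ξ‖ ^ 2 ≤
        ⟪(fderiv ℝ (fun ζ : EuclideanSpace ℝ (Fin N) => φ ‖ζ‖ • ζ) η) ξ, ξ⟫) :
    ∀ η η' : EuclideanSpace ℝ (Fin N),
      min 4 (4 * Γ₁) * (‖η - η'‖ / (1 + ‖η‖ + ‖η'‖)) * PhiFun φ (‖η - η'‖ / 4) ≤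
        ⟪φ ‖η‖ • η - φ ‖η'‖ • η', η - η'⟫ := by
  obtain ⟨hpos, hC1, -, -, -, hmono, -, -, -⟩ := hφ
  have hd : ∀ t > (0 : ℝ), DifferentiableAt ℝ φ t := fun t ht =>
    (hC1.differentiableOn one_ne_zero).differentiableAt (Ioi_mem_nhds ht)
  have hderiv : ∀ t > (0 : ℝ), min 1 Γ₁ * φ t ≤ deriv (fun s => s * φ s) t := by
    intro t ht
    obtain ⟨e, he⟩ : ∃ e : EuclideanSpace ℝ (Fin N), ‖e‖ = 1 :=
      ⟨EuclideanSpace.single ⟨0, hN⟩ 1, by simp⟩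
    have hnorm : ‖t • e‖ = t := by rw [norm_smul, he, mul_one, Real.norm_of_nonneg ht.le]
    have h := hell (t • e) e (norm_pos_iff.mp (hnorm.symm ▸ ht))
    rw [fderiv_norm_smul_self_radial he ht (hd t ht), real_inner_smul_left,
      real_inner_self_eq_norm_sq, hnorm, he, one_pow, mul_one, mul_one] at h
    exact (mul_le_mul_of_nonneg_right (min_le_right _ _) (hpos t ht).le).trans h
  have hmin : min 4 (4 * Γ₁) = 4 * min 1 Γ₁ := by
    rw [mul_min_of_nonneg _ _ (by norm_num : (0 : ℝ) ≤ 4), mul_one]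
  have hm0 : 0 ≤ min 1 Γ₁ := le_min zero_le_one hΓ₁.le
  intro η η'
  rw [hmin]
  rcases le_total ‖η'‖ ‖η‖ with h | h
  · exact inner_ge_of_deriv_ge hm0 (min_le_left _ _) hpos hd hmono.monotoneOn hderiv h
  · have key := inner_ge_of_deriv_ge hm0 (min_le_left _ _) hpos hd hmono.monotoneOn hderiv h
    rw [norm_sub_rev η' η, add_right_comm] at key
    rwa [← inner_neg_neg, neg_sub, neg_sub]

end
end
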